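/- arXiv:2504.16567 — 9 statements merged into one kernel-verified Lean document; each statement's English description precedes it below -/
import Mathlib

section
/- Let A be a finite digraph and n a positive integer. There exists a homomorphism from A to the directed cycle C_n if and only if n divides γ(A). -/
/-- A finite digraph: a number of vertices together with an edge relation on `Fin n`. -/
abbrev FinDigraph := Σ n : ℕ, (Fin n → Fin n → Prop)

/-- `f` is a homomorphism of digraphs from `A` to `B`. -/
def IsHom (A B : FinDigraph) (f : Fin A.1 → Fin B.1) : Prop :=
  ∀ a b : Fin A.1, A.2 a b → B.2 (f a) (f b)

/-- The number of homomorphisms from `A` to `B`. -/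
noncomputable def homN (A B : FinDigraph) : ℕ :=
  Nat.card {f : Fin A.1 → Fin B.1 // IsHom A B f}
/-- An oriented walk in a digraph `A`, with `len` steps: vertices `vert 0, …, vert len`
and signs `sign 0, …, sign (len-1)`, where a `true` sign is a forward edge and a
`false` sign is a backward edge. -/
structure OWalk (A : FinDigraph) where
  len : ℕ
  vert : ℕ → Fin A.1
  sign : ℕ → Bool
  valid : ∀ i < len,
    (sign i = true → A.2 (vert i) (vert (i + 1))) ∧
    (sign i = false → A.2 (vert (i + 1)) (vert i))

/-- The net length of an oriented walk: number of forward steps minus number of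
backward steps. -/
def OWalk.netLength {A : FinDigraph} (W : OWalk A) : ℤ :=
  (((Finset.range W.len).filter fun i => W.sign i = true).card : ℤ) -
  (((Finset.range W.len).filter fun i => W.sign i = false).card : ℤ)

/-- An oriented cycle: a closed oriented walk with at least one step whose vertices
(other than the repeated endpoint) are pairwise distinct. -/
def OWalk.IsCycle {A : FinDigraph} (W : OWalk A) : Prop :=
  0 < W.len ∧ W.vert W.len = W.vert 0 ∧
    ∀ i < W.len, ∀ j < W.len, W.vert i = W.vert j → i = j
/-- The gcd of a set of natural numbers: the number dividing all elements of `S`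
that is divisible by every common divisor of `S` (this is `0` when `S ⊆ {0}`). -/
noncomputable def setGcd (S : Set ℕ) : ℕ :=
  sInf {d : ℕ | (∀ s ∈ S, d ∣ s) ∧ ∀ e : ℕ, (∀ s ∈ S, e ∣ s) → e ∣ d}

/-- `gamma A` is the gcd of the net lengths of all oriented cycles of positive net
length in `A` (`0` if there are none). -/
noncomputable def gamma (A : FinDigraph) : ℕ :=
  setGcd {m : ℕ | 0 < m ∧ ∃ W : OWalk A, W.IsCycle ∧ W.netLength = (m : ℤ)}
/-- The directed cycle `C_n` on vertex set `ℤ/nℤ` (represented as `Fin n`),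
with edges `i → i+1 (mod n)`. -/
def cycleD (n : ℕ) : FinDigraph := ⟨n, fun i j => (i.val + 1) % n = j.val⟩

theorem setGcd_spec (S : Set ℕ) :
    (∀ s ∈ S, setGcd S ∣ s) ∧ ∀ e : ℕ, (∀ s ∈ S, e ∣ s) → e ∣ setGcd S := by
  have hne : {d : ℕ | (∀ s ∈ S, d ∣ s) ∧ ∀ e : ℕ, (∀ s ∈ S, e ∣ s) → e ∣ d}.Nonempty := by
    let I : Ideal ℤ := Ideal.span ((fun s : ℕ => (s : ℤ)) '' S)
    have hI : Ideal.span {Submodule.IsPrincipal.generator I} = I :=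
      Ideal.span_singleton_generator I
    refine ⟨(Submodule.IsPrincipal.generator I).natAbs, ?_, ?_⟩
    · intro s hs
      have h1 : (s : ℤ) ∈ I := Ideal.subset_span ⟨s, hs, rfl⟩
      rw [← hI, Ideal.mem_span_singleton] at h1
      exact Int.natAbs_dvd_natAbs.2 h1
    · intro e he
      have h1 : I ≤ Ideal.span {(e : ℤ)} := by
        refine Ideal.span_le.2 ?_
        rintro _ ⟨s, hs, rfl⟩
        exact Ideal.mem_span_singleton.2 (Int.natCast_dvd_natCast.2 (he s hs))
      have h2 := h1 (Submodule.IsPrincipal.generator_mem I)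
      rw [Ideal.mem_span_singleton] at h2
      exact Int.natCast_dvd.1 h2
  exact Nat.sInf_mem hne

def sg (b : Bool) : ℤ := if b = true then 1 else -1

theorem netLength_eq {A : FinDigraph} (W : OWalk A) :
    W.netLength = ∑ i ∈ Finset.range W.len, sg (W.sign i) := by
  unfold OWalk.netLength
  rw [Finset.card_filter, Finset.card_filter]
  push_cast
  rw [← Finset.sum_sub_distrib]
  refine Finset.sum_congr rfl fun i _ => ?_
  cases W.sign i <;> simp [sg]

/-- Reachability with given net length. -/
inductive NR (A : FinDigraph) : Fin A.1 → Fin A.1 → ℤ → Prop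
  | nil (a : Fin A.1) : NR A a a 0
  | fwd {a b c : Fin A.1} {z : ℤ} : NR A a b z → A.2 b c → NR A a c (z + 1)
  | bwd {a b c : Fin A.1} {z : ℤ} : NR A a b z → A.2 c b → NR A a c (z - 1)

theorem NR.tr {A : FinDigraph} {a b c : Fin A.1} {x y : ℤ} (h : NR A a b x) (k : NR A b c y) :
    NR A a c (x + y) := by
  induction k with
  | nil => simpa using h
  | fwd _ e ih => rw [← add_assoc]; exact ih.fwd e
  | bwd _ e ih => rw [← add_sub_assoc]; exact ih.bwd e

theorem NR.sy {A : FinDigraph} {a b : Fin A.1} {x : ℤ} (h : NR A a b x) :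
    NR A b a (-x) := by
  induction h with
  | nil => simpa using NR.nil _
  | fwd _ e ih =>
    have := ((NR.nil _).bwd e).tr ih
    convert this using 1; ring
  | bwd _ e ih =>
    have := ((NR.nil _).fwd e).tr ih
    convert this using 1; ring

theorem NR.walk {A : FinDigraph} {a b : Fin A.1} {x : ℤ} (h : NR A a b x) :
    ∃ W : OWalk A, W.vert 0 = a ∧ W.vert W.len = b ∧ W.netLength = x := by
  have key : ∀ (W : OWalk A) (c : Fin A.1) (s : Bool),
      (s = true → A.2 (W.vert W.len) c) → (s = false → A.2 c (W.vert W.len)) →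
      ∃ W' : OWalk A, W'.vert 0 = W.vert 0 ∧ W'.vert W'.len = c ∧
        W'.netLength = W.netLength + sg s := by
    intro W c s h1 h2
    refine ⟨⟨W.len + 1, fun k => if k ≤ W.len then W.vert k else c,
      fun k => if k < W.len then W.sign k else s, ?_⟩, ?_, ?_, ?_⟩
    · intro i hi
      rcases Nat.lt_succ_iff_lt_or_eq.1 hi with h | h
      · have h3 : i ≤ W.len := h.le
        have h4 : i + 1 ≤ W.len := h
        simp only [h, h3, h4, if_true]
        exact W.valid i h
      · subst h
        simpa using ⟨h1, h2⟩
    · simp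
    · simp
    · rw [netLength_eq, netLength_eq]
      simp only [Finset.sum_range_succ, lt_irrefl, if_false]
      congr 1
      refine Finset.sum_congr rfl fun i hi => ?_
      rw [if_pos (Finset.mem_range.1 hi)]
  induction h with
  | nil => exact ⟨⟨0, fun _ => a, fun _ => true, by simp⟩, rfl, rfl, by simp [netLength_eq]⟩
  | @fwd b c z _ e ih =>
    obtain ⟨W, h0, h1, h2⟩ := ih
    obtain ⟨W', g0, g1, g2⟩ := key W c true (fun _ => h1 ▸ e) (by simp)
    exact ⟨W', g0.trans h0, g1, by rw [g2, h2]; simp [sg]⟩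
  | @bwd b c z _ e ih =>
    obtain ⟨W, h0, h1, h2⟩ := ih
    obtain ⟨W', g0, g1, g2⟩ := key W c false (by simp) (fun _ => h1 ▸ e)
    exact ⟨W', g0.trans h0, g1, by rw [g2, h2]; simp [sg]; ring⟩

theorem rev_cycle {A : FinDigraph} (W : OWalk A) (hW : W.IsCycle) :
    ∃ W' : OWalk A, W'.IsCycle ∧ W'.netLength = - W.netLength := by
  obtain ⟨hp, hc, hi⟩ := hW
  refine ⟨⟨W.len, fun k => W.vert (W.len - k), fun k => !W.sign (W.len - 1 - k), ?_⟩,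
    ⟨hp, ?_, ?_⟩, ?_⟩
  · intro i h
    have := W.valid (W.len - 1 - i) (by omega)
    have e1 : W.len - 1 - i + 1 = W.len - i := by omega
    have e2 : W.len - (i + 1) = W.len - 1 - i := by omega
    rw [e1] at this
    simp only [e2]
    refine ⟨fun h => this.2 (by simpa using h), fun h => this.1 (by simpa using h)⟩
  · simp [hc]
  · intro i h j h' e
    simp only at e h h'
    rcases Nat.eq_zero_or_pos i with rfl | h0 <;> rcases Nat.eq_zero_or_pos j with rfl | h1
    · rfl
    · rw [Nat.sub_zero, hc] at e
      have := hi _ (by omega) _ (by omega) e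
      omega
    · rw [Nat.sub_zero, hc] at e
      have := hi _ (by omega) _ (by omega) e
      omega
    · have := hi _ (by omega) _ (by omega) e
      omega
  · rw [netLength_eq, netLength_eq, ← Finset.sum_range_reflect (fun i => sg (W.sign i)),
      ← Finset.sum_neg_distrib]
    refine Finset.sum_congr rfl fun i _ => ?_
    simp only
    cases W.sign (W.len - 1 - i) <;> simp [sg]

theorem closed_dvd {A : FinDigraph} {n : ℕ}
    (H : ∀ W : OWalk A, W.IsCycle → (n : ℤ) ∣ W.netLength) :
    ∀ (l : ℕ) (W : OWalk A), W.len = l → W.vert W.len = W.vert 0 → (n : ℤ) ∣ W.netLength := by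
  intro l
  induction l using Nat.strong_induction_on with
  | _ l ih =>
  intro W hl hc
  rcases Nat.eq_zero_or_pos W.len with h0 | h0
  · rw [netLength_eq, h0]; simp
  by_cases hinj : ∀ i < W.len, ∀ j < W.len, W.vert i = W.vert j → i = j
  · exact H W ⟨h0, hc, hinj⟩
  have : ∃ i j, i < j ∧ j < W.len ∧ W.vert i = W.vert j := by
    push Not at hinj
    obtain ⟨i, hi, j, hj, e, ne⟩ := hinj
    rcases lt_or_gt_of_ne ne with h | h
    · exact ⟨i, j, h, hj, e⟩
    · exact ⟨j, i, h, hi, e.symm⟩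
  obtain ⟨i, j, hij, hj, e⟩ := this
  obtain ⟨d, rfl⟩ := Nat.exists_eq_add_of_lt hij
  obtain ⟨r, hr⟩ := Nat.exists_eq_add_of_lt hj
  have h1 := ih (d + 1) (by omega)
    ⟨d + 1, fun k => W.vert (i + k), fun k => W.sign (i + k),
      fun k hk => W.valid (i + k) (by omega)⟩ rfl (by simpa [add_assoc] using e.symm)
  have h2 := ih (i + (r + 1)) (by omega)
    ⟨i + (r + 1), fun k => if k ≤ i then W.vert k else W.vert (k + (d + 1)),
      fun k => if k < i then W.sign k else W.sign (k + (d + 1)), by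
        intro k hk
        rcases lt_trichotomy k i with h | h | h
        · have h3 : k ≤ i := h.le
          have h4 : k + 1 ≤ i := h
          simp only [h, h3, h4, if_true]
          exact W.valid k (by omega)
        · subst h
          have := W.valid (k + (d + 1)) (by omega)
          rw [← add_assoc, ← e] at this
          simp only [lt_irrefl, le_refl, if_true, if_false,
            show ¬ (k + 1 ≤ k) by omega, show k + 1 + (d + 1) = k + d + 1 + 1 by omega,
            ← add_assoc]
          exact this
        · simp only [show ¬ (k < i) by omega, show ¬ (k ≤ i) by omega,
            show ¬ (k + 1 ≤ i) by omega, if_false,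
            show k + 1 + (d + 1) = k + (d + 1) + 1 by omega]
          exact W.valid (k + (d + 1)) (by omega)⟩ rfl (by
        simp only [show ¬ (i + (r + 1) ≤ i) by omega, if_false, Nat.zero_le, if_true]
        rw [← hc, hr]; congr 1; omega)
  have h3 := Int.dvd_add h1 h2
  convert h3 using 1
  rw [netLength_eq, netLength_eq, netLength_eq]
  simp only
  rw [show W.len = i + ((d + 1) + (r + 1)) by omega, Finset.sum_range_add, Finset.sum_range_add _ (d + 1) (r + 1),
    Finset.sum_range_add _ i (r + 1)]
  have e1 : ∑ x ∈ Finset.range i, sg (if x < i then W.sign x else W.sign (x + (d + 1)))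
      = ∑ x ∈ Finset.range i, sg (W.sign x) :=
    Finset.sum_congr rfl fun x hx => by rw [if_pos (Finset.mem_range.1 hx)]
  have e2 : ∑ x ∈ Finset.range (r + 1),
        sg (if i + x < i then W.sign (i + x) else W.sign (i + x + (d + 1)))
      = ∑ x ∈ Finset.range (r + 1), sg (W.sign (i + (d + 1 + x))) :=
    Finset.sum_congr rfl fun x hx => by
      rw [if_neg (by omega)]; congr 2; omega
  rw [e1, e2]; ring

theorem hom_net {A : FinDigraph} {n : ℕ} (f : Fin A.1 → Fin (cycleD n).1)
    (hf : IsHom A (cycleD n) f) (W : OWalk A) : ∀ k ≤ W.len,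
    (n : ℤ) ∣ ((f (W.vert k)).val : ℤ) - (f (W.vert 0)).val
      - ∑ i ∈ Finset.range k, sg (W.sign i) := by
  have hE : ∀ a b, A.2 a b → (n : ℤ) ∣ ((f a).val : ℤ) + 1 - (f b).val := by
    intro a b h
    have h1 : ((f a).val + 1) % n = (f b).val := hf a b h
    rw [← h1]
    push_cast
    exact Int.dvd_self_sub_emod
  intro k
  induction k with
  | zero => intro _; simp
  | succ k ih =>
    intro hk
    have h1 := ih (by omega)
    have h2 := W.valid k hk
    rw [Finset.sum_range_succ]
    cases hs : W.sign k with
    | true =>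
      have h3 := Int.dvd_sub h1 (hE _ _ (h2.1 hs))
      convert h3 using 1
      simp [sg]; ring
    | false =>
      have h3 := Int.dvd_add h1 (hE _ _ (h2.2 hs))
      convert h3 using 1
      simp [sg]; ring

theorem exists_hom {A : FinDigraph} {n : ℕ} (hn : 0 < n)
    (H : ∀ (a : Fin A.1) (z : ℤ), NR A a a z → (n : ℤ) ∣ z) :
    ∃ f : Fin A.1 → Fin (cycleD n).1, IsHom A (cycleD n) f := by
  let S : Setoid (Fin A.1) := ⟨fun a b => ∃ z, NR A a b z,
    fun a => ⟨0, NR.nil a⟩, fun ⟨z, h⟩ => ⟨-z, h.sy⟩, fun ⟨x, h⟩ ⟨y, k⟩ => ⟨x + y, h.tr k⟩⟩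
  let r : Fin A.1 → Fin A.1 := fun a => (Quotient.mk S a).out
  have hr : ∀ a, ∃ z, NR A (r a) a z := fun a => Quotient.mk_out (s := S) a
  choose p hp using hr
  have hn' : (n : ℤ) ≠ 0 := by exact_mod_cast hn.ne'
  have hlt : ∀ a, (p a % n).toNat < n := by
    intro a
    have := Int.emod_nonneg (p a) hn'
    have := Int.emod_lt_of_pos (p a) (show (0 : ℤ) < n by exact_mod_cast hn)
    omega
  refine ⟨fun a => ⟨(p a % n).toNat, hlt a⟩, ?_⟩
  intro a b hab
  have hrr : r a = r b := by
    have : Quotient.mk S a = Quotient.mk S b := Quotient.sound ⟨_, (NR.nil a).fwd hab⟩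
    simp only [r, this]
  have h1 := ((hp a).fwd hab).tr (hrr ▸ (hp b).sy)
  have h2 := H _ _ h1
  change ((p a % n).toNat + 1) % n = (p b % n).toNat
  zify
  rw [Int.toNat_of_nonneg (Int.emod_nonneg _ hn'), Int.toNat_of_nonneg (Int.emod_nonneg _ hn'),
    Int.emod_add_emod]
  exact Int.emod_eq_emod_iff_emod_sub_eq_zero.2 (Int.emod_eq_zero_of_dvd (by simpa [sub_eq_add_neg] using h2))

/-- a finite digraph `A` has a homomorphism to the directed cycle `C_n`
if and only if `n` divides `γ(A)`. -/
theorem stmt0 (A : FinDigraph) (n : ℕ) (hn : 0 < n) :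
    (∃ f : Fin A.1 → Fin (cycleD n).1, IsHom A (cycleD n) f) ↔ n ∣ gamma A := by
  obtain ⟨g1, g2⟩ := setGcd_spec
    {m : ℕ | 0 < m ∧ ∃ W : OWalk A, W.IsCycle ∧ W.netLength = (m : ℤ)}
  constructor
  · rintro ⟨f, hf⟩
    refine g2 n ?_
    rintro m ⟨_, W, hW, hm⟩
    have h := hom_net f hf W W.len le_rfl
    rw [← netLength_eq, hW.2.1, hm] at h
    simpa [Int.natCast_dvd_natCast] using h
  · intro h
    have hpos : ∀ W : OWalk A, W.IsCycle → 0 < W.netLength → (n : ℤ) ∣ W.netLength := by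
      intro W hW h0
      have h1 : (W.netLength.toNat : ℤ) = W.netLength := Int.toNat_of_nonneg h0.le
      rw [← h1]
      exact Int.natCast_dvd_natCast.2 (h.trans (g1 _ ⟨by omega, W, hW, h1.symm⟩))
    have hall : ∀ W : OWalk A, W.IsCycle → (n : ℤ) ∣ W.netLength := by
      intro W hW
      rcases lt_trichotomy W.netLength 0 with h0 | h0 | h0
      · obtain ⟨W', hW', e⟩ := rev_cycle W hW
        have := hpos W' hW' (by omega)
        rw [e] at this
        exact (dvd_neg.1 this)
      · rw [h0]; exact dvd_zero _
      · exact hpos W hW h0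
    refine exists_hom hn ?_
    intro a z hz
    obtain ⟨W, h0, h1, h2⟩ := hz.walk
    rw [← h2]
    exact closed_dvd hall _ W rfl (h1.trans h0.symm)
end

section
/- For all positive integers n and k, the class D_n := {2^{n−m}·C_{2^m} : 0 ≤ m ≤ n, m even} (taken up to isomorphism) can be separated from the class D_n' := {2^{n−m}·C_{2^m} : 0 ≤ m ≤ n, m odd} (taken up to isomorphism) by a non-adaptive left k-query algorithm over ℕ if and only if k ≥ n. -/
/-- `copies m H` is the disjoint union of `m` copies of the digraph `H`. -/
def copies (m : ℕ) (H : FinDigraph) : FinDigraph :=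
  ⟨m * H.1, fun i j =>
    ((finProdFinEquiv (m := m) (n := H.1)).symm i).1 =
      ((finProdFinEquiv (m := m) (n := H.1)).symm j).1 ∧
    H.2 ((finProdFinEquiv (m := m) (n := H.1)).symm i).2
      ((finProdFinEquiv (m := m) (n := H.1)).symm j).2⟩
/-- Isomorphism of digraphs. -/
def Iso (A B : FinDigraph) : Prop :=
  ∃ e : Fin A.1 ≃ Fin B.1, ∀ a b : Fin A.1, A.2 a b ↔ B.2 (e a) (e b)
/-- The class `D_n` of digraphs isomorphic to `2^(n-m)·C_{2^m}` for some even `m ≤ n`. -/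
def Dn (n : ℕ) : Set FinDigraph :=
  {A | ∃ m ≤ n, Even m ∧ Iso A (copies (2 ^ (n - m)) (cycleD (2 ^ m)))}

/-- The class `D_n'` of digraphs isomorphic to `2^(n-m)·C_{2^m}` for some odd `m ≤ n`. -/
def Dn' (n : ℕ) : Set FinDigraph :=
  {A | ∃ m ≤ n, Odd m ∧ Iso A (copies (2 ^ (n - m)) (cycleD (2 ^ m)))}

/-- `F` maps to the cycle of length `N`. -/
def PP (F : FinDigraph) (N : ℕ) : Prop :=
  ∃ φ : Fin F.1 → ZMod N, ∀ a b, F.2 a b → φ b = φ a + 1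

/-- Number of labelings constant along edges. -/
noncomputable def LL (F : FinDigraph) (K : ℕ) : ℕ :=
  Nat.card {g : Fin F.1 → Fin K // ∀ a b, F.2 a b → g a = g b}

theorem LL_pos (F : FinDigraph) (K : ℕ) (hK : 0 < K) : 0 < LL F K := by
  unfold LL
  haveI : Nonempty {g : Fin F.1 → Fin K // ∀ a b, F.2 a b → g a = g b} :=
    ⟨⟨fun _ => ⟨0, hK⟩, fun _ _ _ => rfl⟩⟩
  exact Nat.card_pos

theorem homN_iso (F A B : FinDigraph) (h : Iso A B) : homN F A = homN F B := by
  obtain ⟨e, he⟩ := h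
  unfold homN
  refine Nat.card_congr (Equiv.subtypeEquiv (Equiv.arrowCongr (Equiv.refl _) e) ?_)
  intro f
  unfold IsHom
  refine forall_congr' fun a => forall_congr' fun b => imp_congr_right fun _ => ?_
  simpa using he (f a) (f b)

theorem copies_equiv (M N : ℕ) [NeZero N] :
    ∃ e : Fin (copies M (cycleD N)).1 ≃ Fin M × ZMod N, ∀ a b,
      (copies M (cycleD N)).2 a b ↔ (e a).1 = (e b).1 ∧ (e b).2 = (e a).2 + 1 := by
  have hb : Function.Bijective (fun i : Fin N => ((i.val : ℕ) : ZMod N)) := by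
    rw [Fintype.bijective_iff_injective_and_card]
    refine ⟨?_, by simp [ZMod.card]⟩
    intro i j hij
    have := (ZMod.natCast_eq_natCast_iff' _ _ _).1 hij
    rw [Nat.mod_eq_of_lt i.2, Nat.mod_eq_of_lt j.2] at this
    exact Fin.ext this
  refine ⟨(finProdFinEquiv (m := M) (n := N)).symm.trans
    (Equiv.prodCongr (Equiv.refl _) (Equiv.ofBijective _ hb)), ?_⟩
  intro a b
  refine and_congr Iff.rfl ?_
  change ((((finProdFinEquiv (m := M) (n := N)).symm a).2.val + 1) % N
    = ((finProdFinEquiv (m := M) (n := N)).symm b).2.val) ↔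
    ((((finProdFinEquiv (m := M) (n := N)).symm b).2.val : ℕ) : ZMod N)
      = ((((finProdFinEquiv (m := M) (n := N)).symm a).2.val : ℕ) : ZMod N) + 1
  generalize ((finProdFinEquiv (m := M) (n := N)).symm a).2 = i
  generalize ((finProdFinEquiv (m := M) (n := N)).symm b).2 = j
  rw [← Nat.cast_succ, ZMod.natCast_eq_natCast_iff', Nat.mod_eq_of_lt j.2]
  exact eq_comm

theorem homN_of_PP (F : FinDigraph) (M N : ℕ) [NeZero N] (h : PP F N) :
    homN F (copies M (cycleD N)) = LL F (M * N) := by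
  obtain ⟨φ, hφ⟩ := h
  obtain ⟨e, he⟩ := copies_equiv M N
  have e2 : Fin M × ZMod N ≃ Fin (M * N) :=
    Fintype.equivFinOfCardEq (by simp [ZMod.card])
  unfold homN LL
  let T : Fin F.1 → (Fin (copies M (cycleD N)).1 ≃ Fin (M * N)) := fun v =>
    (e.trans (Equiv.prodCongr (Equiv.refl _) (Equiv.subRight (φ v)))).trans e2
  refine Nat.card_congr (Equiv.subtypeEquiv (Equiv.piCongrRight T) ?_)
  intro f
  unfold IsHom
  refine forall_congr' fun a => forall_congr' fun b => imp_congr_right fun hab => ?_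
  rw [he]
  have := hφ a b hab
  simp only [Equiv.piCongrRight_apply, Pi.map_apply, T, Equiv.trans_apply, EmbeddingLike.apply_eq_iff_eq,
    Equiv.prodCongr_apply, Prod.ext_iff, Prod.map_fst, Prod.map_snd, Equiv.refl_apply,
    Equiv.subRight_apply, this]
  refine and_congr Iff.rfl ⟨fun h => by rw [h]; ring, fun h => ?_⟩
  linear_combination -h

theorem homN_of_not_PP (F : FinDigraph) (M N : ℕ) [NeZero N] (h : ¬ PP F N) :
    homN F (copies M (cycleD N)) = 0 := by
  obtain ⟨e, he⟩ := copies_equiv M N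
  unfold homN
  haveI : IsEmpty {f : Fin F.1 → Fin (copies M (cycleD N)).1 //
      IsHom F (copies M (cycleD N)) f} := by
    refine ⟨fun f => h ⟨fun v => (e (f.1 v)).2, fun a b hab => ?_⟩⟩
    exact ((he _ _).1 (f.2 a b hab)).2
  exact Nat.card_of_isEmpty

theorem PP_dvd (F : FinDigraph) (N N' : ℕ) (hd : N' ∣ N) (h : PP F N) : PP F N' := by
  obtain ⟨φ, hφ⟩ := h
  refine ⟨fun v => ZMod.castHom hd (ZMod N') (φ v), fun a b hab => ?_⟩
  simp only [hφ a b hab, map_add, map_one]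

theorem PP_cycle (N m : ℕ) (hN : 0 < N) : PP (cycleD N) m ↔ m ∣ N := by
  constructor
  · rintro ⟨φ, hφ⟩
    change Fin N → ZMod m at φ
    have key : ∀ i (hi : i < N), φ ⟨i, hi⟩ = φ ⟨0, hN⟩ + (i : ZMod m) := by
      intro i
      induction i with
      | zero => intro hi; simp
      | succ i ih =>
        intro hi
        have h1 := hφ (⟨i, by omega⟩ : Fin N) (⟨i + 1, hi⟩ : Fin N) (Nat.mod_eq_of_lt hi)
        rw [h1, ih (by omega)]
        push_cast
        ring
    have h1 := hφ (⟨N - 1, by omega⟩ : Fin N) (⟨0, hN⟩ : Fin N) (by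
      change (N - 1 + 1) % N = 0
      rw [Nat.sub_add_cancel hN, Nat.mod_self])
    rw [key (N - 1) (by omega)] at h1
    have h2 : ((N - 1 + 1 : ℕ) : ZMod m) = 0 := by
      push_cast
      linear_combination -h1
    rw [Nat.sub_add_cancel hN] at h2
    exact (ZMod.natCast_eq_zero_iff _ _).1 h2
  · intro hd
    refine ⟨fun i => ((i.val : ℕ) : ZMod m), fun a b hab => ?_⟩
    change (a.val + 1) % N = b.val at hab
    beta_reduce
    rw [← hab, ← Nat.cast_succ, ZMod.natCast_eq_natCast_iff', Nat.mod_mod_of_dvd _ hd]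

/-- The digraphs in question. -/
def GG (n m : ℕ) : FinDigraph := copies (2 ^ (n - m)) (cycleD (2 ^ m))

theorem homN_GG (F : FinDigraph) (n m : ℕ) (hm : m ≤ n) (h : PP F (2 ^ m)) :
    homN F (GG n m) = LL F (2 ^ n) := by
  unfold GG
  rw [homN_of_PP F _ _ h, ← pow_add, Nat.sub_add_cancel hm]

theorem homN_GG0 (F : FinDigraph) (n m : ℕ) (h : ¬ PP F (2 ^ m)) :
    homN F (GG n m) = 0 := homN_of_not_PP F _ _ h

theorem sep_GG (n m m' : ℕ) (h : m < m') (hn : m' ≤ n) :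
    homN (cycleD (2 ^ m)) (GG n m) ≠ homN (cycleD (2 ^ m)) (GG n m') := by
  rw [homN_GG _ n m (by omega) ((PP_cycle _ _ (by positivity)).2 dvd_rfl), homN_GG0]
  · exact (LL_pos _ _ (by positivity)).ne'
  · rw [PP_cycle _ _ (by positivity), Nat.pow_dvd_pow_iff_le_right (by norm_num)]
    omega

theorem Iso_refl (A : FinDigraph) : Iso A A := ⟨Equiv.refl _, fun _ _ => Iff.rfl⟩

/-- for positive `n, k`, the classes `D_n` and `D_n'` are separated by a
non-adaptive left `k`-query algorithm over ℕ if and only if `k ≥ n`. -/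
theorem stmt2 (n k : ℕ) (hn : 0 < n) (hk : 0 < k) :
    (∃ (F : Fin k → FinDigraph) (X : Set (Fin k → ℕ)),
      (∀ A ∈ Dn n, (fun i => homN (F i) A) ∈ X) ∧
      (∀ B ∈ Dn' n, (fun i => homN (F i) B) ∉ X)) ↔ n ≤ k := by
  constructor
  · rintro ⟨F, X, hA, hB⟩
    have h1 : ∀ m : Fin n, ∃ i : Fin k, PP (F i) (2 ^ m.val) ∧ ¬ PP (F i) (2 ^ (m.val + 1)) := by
      intro m
      by_contra hcon
      push Not at hcon
      have heq : (fun i => homN (F i) (GG n m.val)) = fun i => homN (F i) (GG n (m.val + 1)) := by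
        funext i
        by_cases hp : PP (F i) (2 ^ m.val)
        · rw [homN_GG _ _ _ (by omega) hp, homN_GG _ _ _ (by omega) (hcon i hp)]
        · rw [homN_GG0 _ _ _ hp, homN_GG0 _ _ _
            (fun h => hp (PP_dvd _ _ _ (pow_dvd_pow 2 (Nat.le_succ _)) h))]
      rcases Nat.even_or_odd m.val with he | ho
      · have a := hA (GG n m.val) ⟨m.val, by omega, he, Iso_refl _⟩
        have b := hB (GG n (m.val + 1)) ⟨m.val + 1, by omega, he.add_one, Iso_refl _⟩
        rw [heq] at a
        exact b a
      · have b := hB (GG n m.val) ⟨m.val, by omega, ho, Iso_refl _⟩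
        have a := hA (GG n (m.val + 1)) ⟨m.val + 1, by omega, ho.add_one, Iso_refl _⟩
        rw [heq] at b
        exact b a
    choose c hc1 hc2 using h1
    have hinj : Function.Injective c := by
      intro x y hxy
      by_contra hne
      rcases lt_or_gt_of_ne (fun h : x.val = y.val => hne (Fin.ext h)) with h | h
      · exact hc2 x (hxy ▸ PP_dvd _ _ _ (pow_dvd_pow 2 h) (hc1 y))
      · exact hc2 y (hxy ▸ PP_dvd _ _ _ (pow_dvd_pow 2 h) (hc1 x))
    simpa using Fintype.card_le_of_injective c hinj
  · intro hnk
    refine ⟨fun i => cycleD (2 ^ i.val),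
      {v | ∃ A ∈ Dn n, v = fun i => homN (cycleD (2 ^ i.val)) A}, fun A hA => ⟨A, hA, rfl⟩, ?_⟩
    rintro B ⟨m', hm', ho, hi'⟩ ⟨A, ⟨m, hm, he, hi⟩, heq⟩
    have key : ∀ i < k, homN (cycleD (2 ^ i)) (GG n m') = homN (cycleD (2 ^ i)) (GG n m) := by
      intro i hik
      have := congrFun heq ⟨i, hik⟩
      simp only at this
      rw [homN_iso _ _ _ hi', homN_iso _ _ _ hi] at this
      exact this
    rcases lt_trichotomy m m' with h | h | h
    · exact sep_GG n m m' h hm' (key m (by omega)).symm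
    · subst h
      exact (Nat.not_even_iff_odd.2 ho) he
    · exact sep_GG n m' m h hm (key m' (by omega))
end

section
/- For every positive integer n, the class D_n := {2^{n−m}·C_{2^m} : 0 ≤ m ≤ n, m even} (taken up to isomorphism) can be separated from the class D_n' := {2^{n−m}·C_{2^m} : 0 ≤ m ≤ n, m odd} (taken up to isomorphism) by a non-adaptive left n-query algorithm over 𝔹. -/
/-- The Boolean homomorphism-existence value: `true` iff there is a homomorphism
from `A` to `B`. -/
noncomputable def homB (A B : FinDigraph) : Bool := decide (0 < homN A B)
theorem homB_iff (A B : FinDigraph) : homB A B = true ↔ ∃ f, IsHom A B f := by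
  unfold homB homN
  rw [decide_eq_true_iff, Nat.card_pos_iff]
  constructor
  · rintro ⟨⟨f, hf⟩, _⟩
    exact ⟨f, hf⟩
  · rintro ⟨f, hf⟩
    exact ⟨⟨f, hf⟩, inferInstance⟩

theorem homB_cycle (A : FinDigraph) (k m i : ℕ) (hk : 0 < k)
    (h : Iso A (copies k (cycleD (2 ^ m)))) :
    homB (cycleD (2 ^ i)) A = true ↔ m ≤ i := by
  obtain ⟨e, he⟩ := h
  rw [homB_iff]
  have hi : 0 < 2 ^ i := by positivity
  have hm : 0 < 2 ^ m := by positivity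
  constructor
  · rintro ⟨f, hf⟩
    let g : Fin (2 ^ i) → ℕ := fun a =>
      ((finProdFinEquiv (m := k) (n := 2 ^ m)).symm (e (f a))).2.val
    have hg : ∀ a b : Fin (2 ^ i), (a.val + 1) % 2 ^ i = b.val → (g a + 1) % 2 ^ m = g b := by
      intro a b hab
      exact ((he _ _).1 (hf a b hab)).2
    have key : ∀ t : ℕ, g ⟨t % 2 ^ i, Nat.mod_lt _ hi⟩ ≡ g ⟨0, hi⟩ + t [MOD 2 ^ m] := by
      intro t
      induction t with
      | zero => simp [Nat.ModEq]
      | succ t ih =>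
        have h1 := hg ⟨t % 2 ^ i, Nat.mod_lt _ hi⟩ ⟨(t + 1) % 2 ^ i, Nat.mod_lt _ hi⟩ (by simp)
        rw [← h1]
        exact (Nat.mod_modEq _ _).trans (ih.add_right 1)
    have h2 := key (2 ^ i)
    simp only [Nat.mod_self] at h2
    have h3 : 0 ≡ 2 ^ i [MOD 2 ^ m] := Nat.ModEq.add_left_cancel' (g ⟨0, hi⟩) h2
    have h4 : 2 ^ m ∣ 2 ^ i := (Nat.modEq_zero_iff_dvd).1 h3.symm
    exact (Nat.pow_dvd_pow_iff_le_right (by norm_num)).1 h4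
  · intro hmi
    let q : Fin (2 ^ i) → Fin (copies k (cycleD (2 ^ m))).1 := fun a =>
      finProdFinEquiv (m := k) (n := 2 ^ m) (⟨0, hk⟩, ⟨a.val % 2 ^ m, Nat.mod_lt _ hm⟩)
    have hq : ∀ a, (finProdFinEquiv (m := k) (n := 2 ^ m)).symm (q a) =
        (⟨0, hk⟩, ⟨a.val % 2 ^ m, Nat.mod_lt _ hm⟩) := fun a =>
      Equiv.symm_apply_apply (finProdFinEquiv (m := k) (n := 2 ^ m)) _
    refine ⟨fun a => e.symm (q a), ?_⟩
    intro a b hab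
    have hab' : (a.val + 1) % 2 ^ i = b.val := hab
    have hd : 2 ^ m ∣ 2 ^ i := pow_dvd_pow 2 hmi
    have h5 : (a.val % 2 ^ m + 1) % 2 ^ m = b.val % 2 ^ m := by
      rw [← hab', Nat.mod_mod_of_dvd _ hd]
      simp
    have h6 : (copies k (cycleD (2 ^ m))).2 (q a) (q b) := by
      refine ⟨(congrArg Prod.fst (hq a)).trans (congrArg Prod.fst (hq b)).symm, ?_⟩
      have ha : ((finProdFinEquiv (m := k) (n := 2 ^ m)).symm (q a)).2.val = a.val % 2 ^ m :=
        congrArg (fun p => p.2.val) (hq a)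
      have hb : ((finProdFinEquiv (m := k) (n := 2 ^ m)).symm (q b)).2.val = b.val % 2 ^ m :=
        congrArg (fun p => p.2.val) (hq b)
      exact (congrArg (fun x => (x + 1) % 2 ^ m) ha).trans (h5.trans hb.symm)
    apply (he _ _).2
    simpa only [Equiv.apply_symm_apply] using h6

/-- for every positive `n`, the classes `D_n` and `D_n'` are separated by a
non-adaptive left `n`-query algorithm over 𝔹. -/
theorem stmt3 (n : ℕ) (hn : 0 < n) :
    ∃ (F : Fin n → FinDigraph) (X : Set (Fin n → Bool)),
      (∀ A ∈ Dn n, (fun i => homB (F i) A) ∈ X) ∧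
      (∀ B ∈ Dn' n, (fun i => homB (F i) B) ∉ X) := by
  refine ⟨fun i => cycleD (2 ^ i.val),
    {v | ∃ A ∈ Dn n, v = fun i : Fin n => homB (cycleD (2 ^ i.val)) A}, ?_, ?_⟩
  · intro A hA
    exact ⟨A, hA, rfl⟩
  · rintro B ⟨m', hm', ho, hB⟩ ⟨A, ⟨m, hm, hev, hA⟩, hv⟩
    have key : ∀ i, i < n → (m' ≤ i ↔ m ≤ i) := by
      intro i hi
      rw [← homB_cycle B _ m' i (by positivity) hB, ← homB_cycle A _ m i (by positivity) hA]
      have := congrFun hv ⟨i, hi⟩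
      simp only at this
      rw [this]
    have hne : m ≠ m' := by
      rintro rfl
      exact (Nat.not_even_iff_odd.2 ho) hev
    rcases lt_or_gt_of_ne hne with h | h
    · have := key m (by omega)
      omega
    · have := key m' (by omega)
      omega
end

section
/- Let 𝒞 be the class of finite digraphs that contain at least one directed cycle and whose shortest directed cycle has length of the form 2^m with m even. Then for every k, the class 𝒞 is not decided by any adaptive left k-query algorithm over ℕ. -/
/-- `A` contains a directed cycle of length `l`: pairwise distinct vertices
`v 0, …, v (l-1)` with an edge from each `v i` to `v ((i+1) % l)`. -/
def HasDirCycle (A : FinDigraph) (l : ℕ) : Prop :=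
  ∃ (hl : 0 < l) (v : Fin l → Fin A.1), Function.Injective v ∧
    ∀ i : Fin l, A.2 (v i) (v ⟨(i.val + 1) % l, Nat.mod_lt _ hl⟩)
/-- The run of an adaptive left query algorithm over ℕ given by query function
`G` (mapping the list of previous answers to the next queried digraph) on input `A`:
`advRunN G A k` is the list of the first `k` answers. -/
noncomputable def advRunN (G : List ℕ → FinDigraph) (A : FinDigraph) : ℕ → List ℕ
  | 0 => []
  | j + 1 => advRunN G A j ++ [homN (G (advRunN G A j)) A]
noncomputable def eZ (M : ℕ) : Fin (2 ^ M) ≃ ZMod (2 ^ M) := (ZMod.finEquiv (2 ^ M)).toEquiv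

noncomputable def BB (M j : ℕ) : FinDigraph :=
  ⟨2 ^ M, fun a b => eZ M b = eZ M a + 2 ^ j⟩

theorem isHom_BB {F : FinDigraph} {M j : ℕ} (f : Fin F.1 → Fin (2 ^ M)) :
    IsHom F (BB M j) f ↔ ∀ a b, F.2 a b → eZ M (f b) = eZ M (f a) + 2 ^ j := Iff.rfl

theorem hom_count {F : FinDigraph} {M j : ℕ} (f₀ : Fin F.1 → Fin (2 ^ M))
    (h : IsHom F (BB M j) f₀) :
    homN F (BB M j) = Nat.card {g : Fin F.1 → ZMod (2 ^ M) // ∀ a b, F.2 a b → g b = g a} := by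
  rw [isHom_BB] at h
  unfold homN
  let E : (Fin F.1 → Fin (2 ^ M)) ≃ (Fin F.1 → ZMod (2 ^ M)) :=
    { toFun := fun f x => eZ M (f x) - eZ M (f₀ x)
      invFun := fun g x => (eZ M).symm (g x + eZ M (f₀ x))
      left_inv := fun f => by funext x; simp
      right_inv := fun g => by funext x; simp }
  refine Nat.card_congr (E.subtypeEquiv fun f => ?_)
  refine (isHom_BB f).trans ?_
  refine forall_congr' fun a => forall_congr' fun b => forall_congr' fun hab => ?_
  change _ ↔ eZ M (f b) - eZ M (f₀ b) = eZ M (f a) - eZ M (f₀ a)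
  rw [h a b hab]
  constructor
  · intro h1; rw [h1]; ring
  · intro h1; linear_combination h1

theorem hom_mono {F : FinDigraph} {M j j' : ℕ} (hj : j ≤ j')
    (h : ∃ f, IsHom F (BB M j) f) : ∃ f, IsHom F (BB M j') f := by
  obtain ⟨f, hf⟩ := h
  obtain ⟨d, rfl⟩ := Nat.exists_eq_add_of_le hj
  refine ⟨fun x => (eZ M).symm (2 ^ d * eZ M (f x)), ?_⟩
  refine (isHom_BB _).2 fun a b hab => ?_
  have := (isHom_BB f).1 hf a b hab
  simp only [Equiv.apply_symm_apply]
  rw [this]; ring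

theorem hom_zero {F : FinDigraph} {M j : ℕ} (h : ¬ ∃ f, IsHom F (BB M j) f) :
    homN F (BB M j) = 0 := by
  unfold homN
  have : IsEmpty {f : Fin F.1 → Fin (BB M j).1 // IsHom F (BB M j) f} :=
    ⟨fun f => h ⟨f.1, f.2⟩⟩
  exact Nat.card_of_isEmpty

theorem run_eq (k : ℕ) (G : List ℕ → FinDigraph) (M t : ℕ) (ht : t ≤ k) :
    ∃ a r, a + 2 ^ (k - t) ≤ 2 ^ k ∧
      ∀ j, a ≤ j → j ≤ a + 2 ^ (k - t) → advRunN G (BB M j) t = r := by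
  induction t with
  | zero => exact ⟨0, [], by simp, fun j _ _ => rfl⟩
  | succ t ih =>
    obtain ⟨a, r, ha, hr⟩ := ih (by omega)
    have h2 : 2 ^ (k - t) = 2 ^ (k - (t + 1)) + 2 ^ (k - (t + 1)) := by
      rw [show k - t = (k - (t + 1)) + 1 by omega, pow_succ]; ring
    rw [h2] at ha hr
    generalize 2 ^ (k - (t + 1)) = p at *
    by_cases hm : ∃ f, IsHom (G r) (BB M (a + p)) f
    · refine ⟨a + p, r ++ [Nat.card {g : Fin (G r).1 → ZMod (2 ^ M) //
        ∀ a b, (G r).2 a b → g b = g a}], by omega, fun j h1 h3 => ?_⟩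
      obtain ⟨f, hf⟩ := hom_mono h1 hm
      rw [advRunN, hr j (by omega) (by omega), hom_count f hf]
    · refine ⟨a, r ++ [0], by omega, fun j h1 h3 => ?_⟩
      rw [advRunN, hr j (by omega) (by omega), hom_zero fun h => hm (hom_mono h3 h)]

theorem cyc_dvd {M j l : ℕ} (hj : j ≤ M) (h : HasDirCycle (BB M j) l) : 2 ^ (M - j) ∣ l := by
  obtain ⟨hl, v, -, hv⟩ := h
  have key : ∀ t (ht : t < l), eZ M (v ⟨t, ht⟩) = eZ M (v ⟨0, hl⟩) + t * 2 ^ j := by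
    intro t
    induction t with
    | zero => intro ht; simp
    | succ t ih =>
      intro ht
      have h1 : eZ M (v ⟨(t + 1) % l, Nat.mod_lt _ hl⟩) = eZ M (v ⟨t, by omega⟩) + 2 ^ j :=
        hv ⟨t, by omega⟩
      simp only [Nat.mod_eq_of_lt ht] at h1
      rw [h1, ih]; push_cast; ring
  have h1 : eZ M (v ⟨(l - 1 + 1) % l, Nat.mod_lt _ hl⟩) = eZ M (v ⟨l - 1, by omega⟩) + 2 ^ j :=
    hv ⟨l - 1, by omega⟩
  have h0 : (l - 1 + 1) % l = 0 := by rw [Nat.sub_add_cancel hl, Nat.mod_self]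
  simp only [h0] at h1
  rw [key (l - 1) (by omega)] at h1
  have h2 : ((l * 2 ^ j : ℕ) : ZMod (2 ^ M)) = 0 := by
    have : l = l - 1 + 1 := by omega
    rw [this]
    generalize l - 1 = q at *
    push_cast
    linear_combination -h1
  rw [ZMod.natCast_eq_zero_iff] at h2
  have h3 : 2 ^ (M - j) * 2 ^ j = 2 ^ M := by rw [← pow_add, Nat.sub_add_cancel hj]
  rw [← h3] at h2
  exact Nat.dvd_of_mul_dvd_mul_right (k := 2 ^ j) (by positivity) h2

theorem cyc_exists {M j : ℕ} (hj : j ≤ M) : HasDirCycle (BB M j) (2 ^ (M - j)) := by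
  have hMj : 2 ^ (M - j) * 2 ^ j = 2 ^ M := by rw [← pow_add, Nat.sub_add_cancel hj]
  refine ⟨by positivity, fun t => (eZ M).symm ((t.val * 2 ^ j : ℕ) : ZMod (2 ^ M)), ?_, ?_⟩
  · intro s t hst
    have h := (eZ M).symm.injective hst
    rw [ZMod.natCast_eq_natCast_iff] at h
    have hlt : ∀ u : Fin (2 ^ (M - j)), u.val * 2 ^ j < 2 ^ M := fun u => by
      rw [← hMj]; exact Nat.mul_lt_mul_of_pos_right u.2 (by positivity)
    have h' := Nat.ModEq.eq_of_lt_of_lt h (hlt s) (hlt t)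
    exact Fin.ext (Nat.eq_of_mul_eq_mul_right (by positivity) h')
  · intro i
    change eZ M ((eZ M).symm _) = eZ M ((eZ M).symm _) + 2 ^ j
    simp only [Equiv.apply_symm_apply]
    have : (((i.val + 1) % 2 ^ (M - j) * 2 ^ j : ℕ) : ZMod (2 ^ M))
        = (((i.val + 1) * 2 ^ j : ℕ) : ZMod (2 ^ M)) := by
      rw [ZMod.natCast_eq_natCast_iff, ← hMj]
      exact Nat.ModEq.mul_right' _ (Nat.mod_modEq _ _)
    rw [this]; push_cast; ring

theorem class_iff {M j : ℕ} (hj : j ≤ M) :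
    (∃ m : ℕ, Even m ∧ HasDirCycle (BB M j) (2 ^ m) ∧
      ∀ l : ℕ, HasDirCycle (BB M j) l → 2 ^ m ≤ l) ↔ Even (M - j) := by
  constructor
  · rintro ⟨m, hm, hc, hmin⟩
    have h1 := hmin _ (cyc_exists hj)
    have h2 := Nat.le_of_dvd (by positivity) (cyc_dvd hj hc)
    have := Nat.pow_right_injective (le_refl 2) (le_antisymm h1 h2)
    rwa [← this]
  · intro h
    exact ⟨M - j, h, cyc_exists hj, fun l hl => Nat.le_of_dvd hl.1 (cyc_dvd hj hl)⟩

/-- the class of digraphs whose shortest directed cycle has length `2^m`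
with `m` even is not decided by any adaptive left `k`-query algorithm over ℕ. -/
theorem stmt5 (k : ℕ) (G : List ℕ → FinDigraph) (X : Set (List ℕ)) :
    ¬ ∀ A : FinDigraph,
      ((∃ m : ℕ, Even m ∧ HasDirCycle A (2 ^ m) ∧ ∀ l : ℕ, HasDirCycle A l → 2 ^ m ≤ l)
        ↔ advRunN G A k ∈ X) := by
  intro H
  obtain ⟨a, r, ha, hr⟩ := run_eq k G (2 ^ k) k le_rfl
  simp only [Nat.sub_self, pow_zero] at ha hr
  have h1 := H (BB (2 ^ k) a)
  have h2 := H (BB (2 ^ k) (a + 1))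
  rw [class_iff (by omega), hr _ (by omega) (by omega)] at h1 h2
  have h3 := h1.trans h2.symm
  rw [show 2 ^ k - a = (2 ^ k - (a + 1)) + 1 by omega, Nat.even_add_one] at h3
  exact not_iff_self h3
end

section
/- The class of all finite digraphs that contain a directed cycle is decided by an adaptive left 2-query algorithm over ℕ, but for every k it is not decided by any non-adaptive left k-query algorithm over ℕ. -/
lemma homN_pos_iff (A B : FinDigraph) : homN A B ≠ 0 ↔ ∃ f, IsHom A B f := by
  unfold homN
  rw [← Nat.pos_iff_ne_zero, Finite.card_pos_iff, nonempty_subtype]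

lemma homN_one (A : FinDigraph) : homN ⟨1, fun _ _ => False⟩ A = A.1 := by
  unfold homN
  have e : {f : Fin 1 → Fin A.1 // IsHom ⟨1, fun _ _ => False⟩ A f} ≃ Fin A.1 :=
    (Equiv.subtypeUnivEquiv (fun f a b h => h.elim)).trans (Equiv.funUnique (Fin 1) (Fin A.1))
  rw [Nat.card_congr e, Nat.card_fin]

lemma cycle_iff (A : FinDigraph) : (∃ l, HasDirCycle A l) ↔
    ∃ f, IsHom ⟨A.1 + 1, fun x y => y.val = x.val + 1⟩ A f := by
  constructor
  · rintro ⟨l, hl, v, hv, h⟩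
    refine ⟨fun i => v ⟨i.val % l, Nat.mod_lt _ hl⟩, ?_⟩
    intro a b hab
    have := h ⟨a.val % l, Nat.mod_lt _ hl⟩
    convert this using 3
    change b.val = a.val + 1 at hab
    rw [hab]
    simp
  · rintro ⟨f, hf⟩
    change Fin (A.1 + 1) → Fin A.1 at f
    replace hf : ∀ a b : Fin (A.1 + 1), b.val = a.val + 1 → A.2 (f a) (f b) := hf
    have hex : ∃ d : ℕ, 0 < d ∧ ∃ i j : Fin (A.1 + 1), j.val = i.val + d ∧ f i = f j := by
      obtain ⟨x, y, hxy, he⟩ := Fintype.exists_ne_map_eq_of_card_lt f (by simp)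
      rcases lt_or_gt_of_ne hxy with h | h
      · exact ⟨y.val - x.val, by have : x.val < y.val := h; omega, x, y,
          by have : x.val < y.val := h; omega, he⟩
      · exact ⟨x.val - y.val, by have : y.val < x.val := h; omega, y, x,
          by have : y.val < x.val := h; omega, he.symm⟩
    classical
    obtain ⟨hd, i, j, hij, he⟩ := Nat.find_spec hex
    have hmin := fun m => @Nat.find_min _ _ hex m
    set d := Nat.find hex with hdd
    have hj := j.isLt
    refine ⟨d, hd, fun t => f ⟨i.val + t.val, by have := t.isLt; omega⟩, ?_, ?_⟩
    · have key : ∀ s t : Fin d, s < t →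
          f ⟨i.val + s.val, by have := s.isLt; omega⟩ ≠ f ⟨i.val + t.val, by have := t.isLt; omega⟩ := by
        intro s t hst h
        have hst' : s.val < t.val := hst
        have := t.isLt
        refine hmin (t.val - s.val) (by omega) ⟨by omega, _, _, ?_, h⟩
        simp only; omega
      intro s t h
      by_contra hne
      rcases lt_or_gt_of_ne hne with h' | h'
      · exact key _ _ h' h
      · exact key _ _ h' h.symm
    · intro t
      have ht := t.isLt
      by_cases hl : t.val + 1 < d
      · apply hf
        simp only [Nat.mod_eq_of_lt hl]
        omega
      · have h1 : t.val + 1 = d := by omega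
        have h2 : f ⟨i.val + (t.val + 1) % d, by rw [h1, Nat.mod_self]; omega⟩ = f j := by
          rw [← he]; congr 1; ext; simp [h1]
        simp only
        rw [h2]
        apply hf
        simp only
        omega

/-- Connectedness. -/
def Conn {α : Type} (r : α → α → Prop) : Prop :=
  Nonempty α ∧ ∀ (β : Type) (φ : α → β), (∀ a b, r a b → φ a = φ b) → ∀ a b, φ a = φ b

abbrev fib {α : Type} (r : α → α → Prop) (c : Quot r) : Type := {a : α // Quot.mk r a = c}

abbrev fibR {α : Type} (r : α → α → Prop) (c : Quot r) : fib r c → fib r c → Prop :=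
  fun a b => r a.1 b.1

lemma conn_fib {α : Type} (r : α → α → Prop) (c : Quot r) : Conn (fibR r c) := by
  classical
  constructor
  · obtain ⟨a, ha⟩ := Quot.exists_rep c
    exact ⟨⟨a, ha⟩⟩
  · intro β φ h a b
    let Φ : α → Option β := fun x => if hx : Quot.mk r x = c then some (φ ⟨x, hx⟩) else none
    have hΦ : ∀ x y, r x y → Φ x = Φ y := by
      intro x y hxy
      have e : Quot.mk r x = Quot.mk r y := Quot.sound hxy
      by_cases hx : Quot.mk r x = c
      · have hy : Quot.mk r y = c := e ▸ hx
        simp only [Φ, hx, hy, dif_pos]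
        exact congrArg some (h ⟨x, hx⟩ ⟨y, hy⟩ hxy)
      · have hy : ¬ Quot.mk r y = c := e ▸ hx
        simp only [Φ, hx, hy, dif_neg, not_false_eq_true]
    have := congrArg (Quot.lift Φ hΦ) (a.2.trans b.2.symm)
    simpa [Φ, a.2, b.2] using this

def homPi {α γ : Type} (r : α → α → Prop) (s : γ → γ → Prop) :
    (r →r s) ≃ ((c : Quot r) → (fibR r c →r s)) where
  toFun f c := ⟨fun a => f a.1, fun h => f.map_rel h⟩
  invFun g := ⟨fun a => g (Quot.mk r a) ⟨a, rfl⟩, by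
    intro a b hab
    have key : ∀ (c : Quot r) (h : Quot.mk r b = c), g (Quot.mk r b) ⟨b, rfl⟩ = g c ⟨b, h⟩ := by
      intro c h; subst h; rfl
    rw [key (Quot.mk r a) (Quot.sound hab).symm]
    exact (g (Quot.mk r a)).map_rel hab⟩
  left_inv f := rfl
  right_inv g := by
    funext c
    ext ⟨a, h⟩
    subst h
    rfl

abbrev pathR (K : ℕ) : Fin K → Fin K → Prop := fun x y => y.val = x.val + 1
abbrev cycR (m : ℕ) : ZMod m → ZMod m → Prop := fun x y => y = x + 1
abbrev copR (ι : Type) {γ : Type} (s : γ → γ → Prop) : ι × γ → ι × γ → Prop :=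
  fun x y => x.1 = y.1 ∧ s x.2 y.2

lemma card_cop {α ι γ : Type} {r : α → α → Prop} (hr : Conn r) (s : γ → γ → Prop) :
    Nat.card (r →r copR ι s) = Nat.card ι * Nat.card (r →r s) := by
  obtain ⟨⟨a0⟩, hc⟩ := hr
  rw [← Nat.card_prod]
  refine Nat.card_congr ⟨fun f => ((f a0).1, ⟨fun a => (f a).2, fun h => (f.map_rel h).2⟩),
    fun p => ⟨fun a => (p.1, p.2 a), fun h => ⟨rfl, p.2.map_rel h⟩⟩, ?_, ?_⟩
  · intro f
    ext a
    · exact hc _ (fun a => (f a).1) (fun a b h => (f.map_rel h).1) a0 a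
    · rfl
  · intro p; rfl

lemma card_sum' {α γ δ : Type} [Finite α] [Finite γ] [Finite δ]
    {r : α → α → Prop} (hr : Conn r) (s : γ → γ → Prop) (t : δ → δ → Prop) :
    Nat.card (r →r Sum.LiftRel s t) = Nat.card (r →r s) + Nat.card (r →r t) := by
  obtain ⟨⟨a0⟩, hc⟩ := hr
  have : Finite (r →r s) := Finite.of_injective _ RelHom.coe_fn_injective
  have : Finite (r →r t) := Finite.of_injective _ RelHom.coe_fn_injective
  rw [← Nat.card_sum]
  symm
  let F : (r →r s) ⊕ (r →r t) → (r →r Sum.LiftRel s t) := fun x => match x with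
    | .inl f => ⟨fun a => .inl (f a), fun h => .inl (f.map_rel h)⟩
    | .inr f => ⟨fun a => .inr (f a), fun h => .inr (f.map_rel h)⟩
  refine Nat.card_congr (Equiv.ofBijective F ⟨?_, ?_⟩)
  · rintro (f | f) (g | g) h
    · congr 1; ext a; exact Sum.inl_injective (DFunLike.congr_fun h a)
    · exact absurd (DFunLike.congr_fun h a0) (by simp [F])
    · exact absurd (DFunLike.congr_fun h a0) (by simp [F])
    · congr 1; ext a; exact Sum.inr_injective (DFunLike.congr_fun h a)
  · intro f
    have hl : ∀ a b, (f a).isLeft = (f b).isLeft := hc _ _ (by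
      intro a b h
      have h2 := f.map_rel h
      generalize f a = x at h2 ⊢
      generalize f b = y at h2 ⊢
      cases h2 <;> rfl)
    rcases h0 : f a0 with x | y
    · have : ∀ a, ∃ x, f a = .inl x := fun a => Sum.isLeft_iff.1 (by rw [hl a a0, h0]; rfl)
      choose g hg using this
      refine ⟨.inl ⟨g, ?_⟩, ?_⟩
      · intro a b h
        have := f.map_rel h
        rw [hg, hg] at this
        simpa using this
      · ext a : 1; exact (hg a).symm
    · have : ∀ a, ∃ x, f a = .inr x := fun a => Sum.isRight_iff.1 (by
        rw [← Sum.not_isLeft, hl a a0, h0]; simp)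
      choose g hg using this
      refine ⟨.inr ⟨g, ?_⟩, ?_⟩
      · intro a b h
        have := f.map_rel h
        rw [hg, hg] at this
        simpa using this
      · ext a : 1; exact (hg a).symm

/-- lifting -/
lemma lift_cyc {α : Type} [Finite α] {r : α → α → Prop} {m : ℕ} [NeZero m]
    (hm : Nat.card α < m) (f : r →r cycR m) :
    ∃ p : α → ℕ, (∀ a b, r a b → p b = p a + 1) ∧ ∀ a, 0 < p a ∧ p a < m := by
  have : ∃ z : ZMod m, ∀ a, f a ≠ z := by
    by_contra hcon
    push Not at hcon
    have := Nat.card_le_card_of_surjective f hcon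
    rw [Nat.card_zmod] at this
    omega
  obtain ⟨z, hz⟩ := this
  refine ⟨fun a => (f a - z).val, ?_, fun a => ⟨ZMod.val_pos.2 (sub_ne_zero.2 (hz a)), ZMod.val_lt _⟩⟩
  intro a b h
  have h1 : f b = f a + 1 := f.map_rel h
  have h2 : f b - z = (f a - z) + 1 := by rw [h1]; ring
  have h3 : f b - z ≠ 0 := sub_ne_zero.2 (hz b)
  have hlt := ZMod.val_lt (f a - z)
  have h4 : f b - z = (((f a - z).val + 1 : ℕ) : ZMod m) := by
    rw [h2]; push_cast; rw [ZMod.natCast_zmod_val]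
  have h5 : (f a - z).val + 1 < m := by
    rcases Nat.lt_or_ge ((f a - z).val + 1) m with h | h
    · exact h
    · exfalso
      apply h3
      rw [h4, show (f a - z).val + 1 = m by omega]
      simp
  simp only
  rw [h4, ZMod.val_natCast, Nat.mod_eq_of_lt h5]

lemma card_cyc {α : Type} {r : α → α → Prop} (hr : Conn r) {m : ℕ} 
    (p : α → ℕ) (hp : ∀ a b, r a b → p b = p a + 1) :
    Nat.card (r →r cycR m) = m := by
  obtain ⟨⟨a0⟩, hc⟩ := hr
  conv_rhs => rw [← Nat.card_zmod m]
  refine Nat.card_congr ⟨fun f => f a0 - p a0, fun z => ⟨fun a => z + p a, ?_⟩, ?_, ?_⟩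
  · intro a b h
    simp only [cycR, hp a b h]
    push_cast; ring
  · intro f
    ext a
    have := hc _ (fun a => f a - (p a : ZMod m)) (by
      intro a b h
      have h1 : f b = f a + 1 := f.map_rel h
      simp only [h1, hp a b h]
      push_cast; ring) a0 a
    have h3 : f a0 - (p a0 : ZMod m) = f a - p a := this
    change f a0 - (p a0 : ZMod m) + p a = f a
    rw [h3]; ring
  · intro z; simp

lemma norm_pot {α : Type} [Finite α] {r : α → α → Prop} (hr : Conn r)
    (p : α → ℕ) (hp : ∀ a b, r a b → p b = p a + 1) :
    ∃ (q : α → ℕ) (a0 a1 : α), (∀ a b, r a b → q b = q a + 1) ∧ q a0 = 0 ∧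
      (∀ a, q a ≤ q a1) ∧ q a1 < Nat.card α := by
  have := hr.1
  have hf : ∃ q : α → ℕ, (∀ a b, r a b → q b = q a + 1) ∧ ∀ a, 0 < q a ∧ q a < Nat.card α + 1 :=
    lift_cyc (r := r) (m := Nat.card α + 1) (by omega)
      ⟨fun a => (p a : ZMod _), by intro a b h; simp [hp a b h]⟩
  obtain ⟨q, hq, hb⟩ := hf
  obtain ⟨a0, h0⟩ := Finite.exists_min q
  obtain ⟨a1, h1⟩ := Finite.exists_max q
  refine ⟨fun a => q a - q a0, a0, a1, ?_, by simp, fun a => ?_, ?_⟩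
  · intro a b h
    have := hq a b h
    have := h0 a
    simp only
    omega
  · have := h1 a
    simp only
    omega
  · have := hb a0
    have := hb a1
    simp only
    omega

lemma card_path {α : Type} {r : α → α → Prop} (hr : Conn r) (K : ℕ)
    (q : α → ℕ) (a0 a1 : α) (hq : ∀ a b, r a b → q b = q a + 1) (h0 : q a0 = 0)
    (h1 : ∀ a, q a ≤ q a1) :
    Nat.card (r →r pathR K) = K - q a1 := by
  obtain ⟨-, hc⟩ := hr
  have key : ∀ (f : r →r pathR K) a, (f a).val = (f a0).val + q a := by
    intro f a
    have := hc _ (fun a => ((f a).val : ℤ) - q a) (by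
      intro a b h
      have h1 : (f b).val = (f a).val + 1 := f.map_rel h
      simp only [h1, hq a b h]
      push_cast; ring) a0 a
    simp only [h0] at this
    omega
  conv_rhs => rw [← Nat.card_fin (K - q a1)]
  refine Nat.card_congr ⟨fun f => ⟨(f a0).val, ?_⟩,
    fun z => ⟨fun a => ⟨z.val + q a, ?_⟩, ?_⟩, ?_, ?_⟩
  · have := key f a1
    have := (f a1).isLt
    omega
  · have := z.isLt
    have := h1 a
    omega
  · intro a b h
    simp only [pathR, hq a b h]
    omega
  · intro f
    ext a
    simp [key f a]
  · intro z; ext; simp [h0]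

lemma main_conn {α : Type} [Finite α] {r : α → α → Prop} (hr : Conn r) (K : ℕ)
    (hK : Nat.card α ≤ K) :
    Nat.card (r →r copR (ZMod (K+1)) (pathR (K+1))) =
    Nat.card (r →r Sum.LiftRel (cycR (K+1)) (copR (ZMod (K+1)) (pathR K))) := by
  rw [card_sum' hr, card_cop hr, card_cop hr, Nat.card_zmod]
  by_cases hp : ∃ p : α → ℕ, ∀ a b, r a b → p b = p a + 1
  · obtain ⟨p, hp⟩ := hp
    obtain ⟨q, a0, a1, hq, h0, h1, h2⟩ := norm_pot hr p hp
    rw [card_cyc hr p hp, card_path hr _ q a0 a1 hq h0 h1, card_path hr _ q a0 a1 hq h0 h1]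
    rw [show K + 1 - q a1 = (K - q a1) + 1 by omega]
    ring
  · have e1 : ∀ L, IsEmpty (r →r pathR L) := fun L =>
      ⟨fun f => hp ⟨fun a => (f a).val, fun a b h => f.map_rel h⟩⟩
    have e2 : IsEmpty (r →r cycR (K+1)) := ⟨fun f => by
      obtain ⟨p, h, -⟩ := lift_cyc (by omega) f
      exact hp ⟨p, h⟩⟩
    have := e1 K
    have := e1 (K+1)
    simp

lemma main_all {α : Type} [Finite α] (r : α → α → Prop) (K : ℕ) (hK : Nat.card α ≤ K) :
    Nat.card (r →r copR (ZMod (K+1)) (pathR (K+1))) =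
    Nat.card (r →r Sum.LiftRel (cycR (K+1)) (copR (ZMod (K+1)) (pathR K))) := by
  classical
  have : Fintype (Quot r) := Fintype.ofFinite _
  rw [Nat.card_congr (homPi r _), Nat.card_congr (homPi r _), Nat.card_pi, Nat.card_pi]
  refine Finset.prod_congr rfl fun c _ => main_conn (conn_fib r c) K ?_
  exact (Finite.card_subtype_le _).trans hK

/-- transport -/
noncomputable def toFD {γ : Type} [Fintype γ] (s : γ → γ → Prop) : FinDigraph :=
  ⟨Fintype.card γ, fun x y => s ((Fintype.equivFin γ).symm x) ((Fintype.equivFin γ).symm y)⟩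

lemma homN_toFD {γ : Type} [Fintype γ] (s : γ → γ → Prop) (F : FinDigraph) :
    homN F (toFD s) = Nat.card (F.2 →r s) := by
  unfold homN
  refine Nat.card_congr ⟨fun f => ⟨fun a => (Fintype.equivFin γ).symm (f.1 a), fun h => f.2 _ _ h⟩,
    fun f => ⟨fun a => Fintype.equivFin γ (f a), ?_⟩, ?_, ?_⟩
  · intro a b h
    simpa [toFD] using f.map_rel h
  · intro f
    apply Subtype.ext
    funext a
    exact (Fintype.equivFin γ).apply_symm_apply _
  · intro f
    ext a
    simp

lemma acyclic_of {γ : Type} [Fintype γ] (s : γ → γ → Prop) (φ : γ → ℕ)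
    (h : ∀ x y, s x y → φ x < φ y) : ¬ ∃ l, HasDirCycle (toFD s) l := by
  rintro ⟨l, hl, v, -, hv⟩
  have : Nonempty (Fin l) := ⟨⟨0, hl⟩⟩
  obtain ⟨i, hi⟩ := Finite.exists_max (fun i => φ ((Fintype.equivFin γ).symm (v i)))
  exact absurd (h _ _ (hv i)) (not_lt.2 (hi _))

lemma cyclic_B (K : ℕ) {δ : Type} [Fintype δ] (t : δ → δ → Prop) :
    HasDirCycle (toFD (Sum.LiftRel (cycR (K+1)) t)) (K+1) := by
  refine ⟨by omega, fun i => Fintype.equivFin _ (.inl (i.val : ZMod (K+1))), ?_, ?_⟩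
  · intro i j h
    have h := Sum.inl_injective ((Fintype.equivFin _).injective h)
    rw [ZMod.natCast_eq_natCast_iff'] at h
    rw [Nat.mod_eq_of_lt i.isLt, Nat.mod_eq_of_lt j.isLt] at h
    exact Fin.ext h
  · intro i
    simp [toFD]

theorem stmt7 :
    (∃ (G₁ : FinDigraph) (G₂ : ℕ → FinDigraph) (X : Set (ℕ × ℕ)),
      ∀ A : FinDigraph,
        (∃ l : ℕ, HasDirCycle A l) ↔ (homN G₁ A, homN (G₂ (homN G₁ A)) A) ∈ X) ∧
    (∀ (k : ℕ) (F : Fin k → FinDigraph) (X : Set (Fin k → ℕ)),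
      ¬ ∀ A : FinDigraph, ((∃ l : ℕ, HasDirCycle A l) ↔ (fun i => homN (F i) A) ∈ X)) := by
  constructor
  · refine ⟨⟨1, fun _ _ => False⟩, fun n => ⟨n + 1, fun x y => y.val = x.val + 1⟩,
      {p | p.2 ≠ 0}, fun A => ?_⟩
    rw [homN_one, cycle_iff, Set.mem_ofPred_eq, homN_pos_iff]
  · intro k F X h
    let K := ∑ i, (F i).1
    have e : (fun i => homN (F i) (toFD (copR (ZMod (K+1)) (pathR (K+1))))) =
        (fun i => homN (F i) (toFD (Sum.LiftRel (cycR (K+1)) (copR (ZMod (K+1)) (pathR K))))) := by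
      funext i
      rw [homN_toFD, homN_toFD]
      apply main_all
      rw [Nat.card_fin]
      exact Finset.single_le_sum (f := fun i => (F i).1) (fun _ _ => Nat.zero_le _) (Finset.mem_univ i)
    refine acyclic_of (copR (ZMod (K+1)) (pathR (K+1))) (fun x => x.2.val) ?_ ((h _).2 ?_)
    · rintro x y ⟨-, hxy⟩
      change y.2.val = x.2.val + 1 at hxy
      change x.2.val < y.2.val
      omega
    · rw [e]
      exact (h _).1 ⟨_, cyclic_B K _⟩
end

section
/- Let n ≥ 1 and let A = (V,R) be a finite n-ary structure. For all positive integers d and m: hom(A, m·C_d^n) = 0 if d does not divide γ(A*), and hom(A, m·C_d^n) = (m·d)^{c(A*)} if d divides γ(A*). -/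
/-- The number of connected components of a digraph: the number of equivalence
classes of the equivalence relation generated by the edge relation. -/
noncomputable def comps (A : FinDigraph) : ℕ := Nat.card (Quot A.2)
/-- A finite `n`-ary structure: a finite domain `Fin v` together with an `n`-ary
relation on it (tuples modeled as `Fin n → Fin v`). -/
abbrev NStruct (n : ℕ) := Σ v : ℕ, ((Fin n → Fin v) → Prop)

/-- `f` is a homomorphism of `n`-ary structures from `A` to `B`. -/
def IsHomS {n : ℕ} (A B : NStruct n) (f : Fin A.1 → Fin B.1) : Prop :=
  ∀ t : Fin n → Fin A.1, A.2 t → B.2 (f ∘ t)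

/-- The `n`-ary cycle of length `d`: domain `ℤ/dℤ` (as `Fin d`) with relation
`{(i, i+1, …, i+n-1) : i}` (arithmetic mod `d`). -/
def naryCycle (n d : ℕ) : NStruct n :=
  ⟨d, fun t => ∃ i : Fin d, ∀ j : Fin n, (t j).val = (i.val + j.val) % d⟩

/-- The digraph `A*` associated to an `n`-ary structure `A`: an edge `a → b` whenever
some tuple of the relation of `A` has `a` and `b` as consecutive entries. -/
def star {n : ℕ} (A : NStruct n) : FinDigraph :=
  ⟨A.1, fun a b => ∃ (t : Fin n → Fin A.1) (i : Fin n) (h : i.val + 1 < n),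
    A.2 t ∧ t i = a ∧ t ⟨i.val + 1, h⟩ = b⟩
/-- The number of homomorphisms between `n`-ary structures. -/
noncomputable def homS {n : ℕ} (A B : NStruct n) : ℕ :=
  Nat.card {f : Fin A.1 → Fin B.1 // IsHomS A B f}

/-- `copiesS m H` is the disjoint union of `m` copies of the `n`-ary structure `H`. -/
def copiesS {n : ℕ} (m : ℕ) (H : NStruct n) : NStruct n :=
  ⟨m * H.1, fun t => ∃ (b : Fin m) (s : Fin n → Fin H.1),
    H.2 s ∧ ∀ j : Fin n, t j = finProdFinEquiv (b, s j)⟩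

open Classical in
theorem aux_dvd_setGcd (S : Set ℕ) (d : ℕ) : d ∣ setGcd S ↔ ∀ s ∈ S, d ∣ s := by
  have hne : {d : ℕ | (∀ s ∈ S, d ∣ s) ∧ ∀ e : ℕ, (∀ s ∈ S, e ∣ s) → e ∣ d}.Nonempty :=
    ⟨Nat.setGcd S, fun s hs => Nat.setGcd_dvd_of_mem hs, fun e he => Nat.dvd_setGcd_iff.2 he⟩
  have h := Nat.sInf_mem hne
  exact ⟨fun hd s hs => hd.trans (h.1 s hs), fun hs => h.2 d hs⟩

def aux_sg (b : Bool) : ℤ := if b = true then 1 else -1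

theorem aux_netLength {A : FinDigraph} (W : OWalk A) :
    W.netLength = ∑ i ∈ Finset.range W.len, aux_sg (W.sign i) := by
  unfold OWalk.netLength
  generalize W.len = L
  induction L with
  | zero => simp
  | succ k ih =>
    rw [Finset.sum_range_succ, ← ih, Finset.range_add_one, Finset.filter_insert, Finset.filter_insert]
    cases h : W.sign k <;> simp [aux_sg] <;> ring

def AuxValid {V : Type*} (E : V → V → Prop) (L : ℕ) (v : ℕ → V) (s : ℕ → Bool) : Prop :=
  ∀ i < L, (s i = true → E (v i) (v (i + 1))) ∧ (s i = false → E (v (i + 1)) (v i))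

theorem aux_closed {V : Type*} (E : V → V → Prop) (d : ℤ)
    (hc : ∀ L v s, AuxValid E L v s → 0 < L → v L = v 0 →
      (∀ i < L, ∀ j < L, v i = v j → i = j) → d ∣ ∑ i ∈ Finset.range L, aux_sg (s i)) :
    ∀ L v s, AuxValid E L v s → v L = v 0 → d ∣ ∑ i ∈ Finset.range L, aux_sg (s i) := by
  intro L
  induction L using Nat.strong_induction_on with
  | _ L ih =>
    intro v s hv h0
    rcases Nat.eq_zero_or_pos L with rfl | hL
    · simp
    by_cases hinj : ∀ i < L, ∀ j < L, v i = v j → i = j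
    · exact hc L v s hv hL h0 hinj
    have : ∃ i j, i < j ∧ j < L ∧ v i = v j := by
      push Not at hinj
      obtain ⟨i, hi, j, hj, hij, hne⟩ := hinj
      rcases lt_or_gt_of_ne hne with h | h
      · exact ⟨i, j, h, hj, hij⟩
      · exact ⟨j, i, h, hi, hij.symm⟩
    obtain ⟨i, j, hij, hjL, hvij⟩ := this
    obtain ⟨p, rfl⟩ := Nat.exists_eq_add_of_lt hij
    obtain ⟨q, rfl⟩ := Nat.exists_eq_add_of_lt hjL
    have h1 := ih (p + 1) (by omega) (fun k => v (i + k)) (fun k => s (i + k))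
      (fun k hk => hv (i + k) (by omega)) (by simpa [add_assoc] using hvij.symm)
    have h2 := ih (i + (q + 1)) (by omega) (fun k => if k < i then v k else v (k + (p + 1)))
      (fun k => if k < i then s k else s (k + (p + 1))) (by
        intro k hk
        rcases lt_trichotomy (k + 1) i with h | h | h
        · have hk' : k < i := by omega
          simpa [h, hk'] using hv k (by omega)
        · have hk' : k < i := by omega
          have := hv k (by omega)
          have e : v (k + 1 + (p + 1)) = v (k + 1) := by
            rw [h, hvij]; congr 1
          simpa [show ¬ (k + 1 < i) by omega, hk', e] using this
        · have := hv (k + (p + 1)) (by omega)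
          have e : k + (p + 1) + 1 = k + 1 + (p + 1) := by omega
          rw [e] at this
          simpa [show ¬ (k + 1 < i) by omega, show ¬ (k < i) by omega] using this) (by
        have e : i + (q + 1) + (p + 1) = i + p + 1 + q + 1 := by omega
        simp only [show ¬ (i + (q + 1) < i) by omega, if_false, e, h0]
        rcases Nat.eq_zero_or_pos i with rfl | hi
        · simpa using hvij
        · simp [hi])
    have e : ∑ k ∈ Finset.range (i + p + 1 + q + 1), aux_sg (s k) =
        (∑ k ∈ Finset.range (p + 1), aux_sg (s (i + k))) +
        ∑ k ∈ Finset.range (i + (q + 1)), aux_sg (if k < i then s k else s (k + (p + 1))) := by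
      rw [show i + p + 1 + q + 1 = i + (p + 1) + (q + 1) by omega,
        Finset.sum_range_add, Finset.sum_range_add, Finset.sum_range_add _ i]
      have a1 : ∑ k ∈ Finset.range i, aux_sg (if k < i then s k else s (k + (p + 1)))
          = ∑ k ∈ Finset.range i, aux_sg (s k) := by
        refine Finset.sum_congr rfl fun k hk => ?_
        rw [if_pos (Finset.mem_range.1 hk)]
      have a2 : ∑ k ∈ Finset.range (q + 1), aux_sg (if i + k < i then s (i + k) else s (i + k + (p + 1)))
          = ∑ k ∈ Finset.range (q + 1), aux_sg (s (i + (p + 1) + k)) := by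
        refine Finset.sum_congr rfl fun k hk => ?_
        rw [if_neg (by omega)]
        congr 2
        omega
      rw [a1, a2]; ring
    rw [e]
    exact dvd_add h1 h2

inductive AuxR {V : Type*} (E : V → V → Prop) : V → V → ℤ → Prop
  | refl (x) : AuxR E x x 0
  | fwd {x y z N} : AuxR E x y N → E y z → AuxR E x z (N + 1)
  | bwd {x y z N} : AuxR E x y N → E z y → AuxR E x z (N + -1)

theorem AuxR.trans' {V : Type*} {E : V → V → Prop} {x y z : V} {N M : ℤ}
    (h : AuxR E x y N) (h' : AuxR E y z M) : AuxR E x z (N + M) := by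
  induction h' with
  | refl => simpa using h
  | fwd _ e ih => rw [← add_assoc]; exact ih.fwd e
  | bwd _ e ih => rw [← add_assoc]; exact ih.bwd e

theorem AuxR.symm' {V : Type*} {E : V → V → Prop} {x y : V} {N : ℤ}
    (h : AuxR E x y N) : AuxR E y x (-N) := by
  induction h with
  | refl => simpa using AuxR.refl _
  | fwd _ e ih =>
    have := ((AuxR.refl _).bwd e).trans' ih
    convert this using 1; ring
  | bwd _ e ih =>
    have := ((AuxR.refl _).fwd e).trans' ih
    convert this using 1; ring

theorem AuxR.walk {V : Type*} {E : V → V → Prop} {x y : V} {N : ℤ}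
    (h : AuxR E x y N) : ∃ L v s, AuxValid E L v s ∧ v 0 = x ∧ v L = y ∧
      ∑ i ∈ Finset.range L, aux_sg (s i) = N := by
  have step : ∀ (y z : V) (N : ℤ) (b : Bool), (b = true → E y z) → (b = false → E z y) →
    (∃ L v s, AuxValid E L v s ∧ v 0 = x ∧ v L = y ∧
      ∑ i ∈ Finset.range L, aux_sg (s i) = N) → 
    (∃ L v s, AuxValid E L v s ∧ v 0 = x ∧ v L = z ∧
      ∑ i ∈ Finset.range L, aux_sg (s i) = N + aux_sg b) := by
    rintro y z N b hb hb' ⟨L, v, s, hv, h0, hL, hs⟩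
    refine ⟨L + 1, fun k => if k ≤ L then v k else z, fun k => if k < L then s k else b, ?_, ?_, ?_, ?_⟩
    · intro i hi
      rcases Nat.lt_or_ge i L with h | h
      · simpa [h, h.le, Nat.succ_le_of_lt h] using hv i h
      · obtain rfl : i = L := by omega
        simpa [hL] using And.intro hb hb'
    · simpa using h0
    · simp
    · rw [Finset.sum_range_succ, ← hs]
      congr 1
      · refine Finset.sum_congr rfl fun k hk => ?_
        simp only [if_pos (Finset.mem_range.1 hk)]
      · simp
  induction h with
  | refl => exact ⟨0, fun _ => x, fun _ => true, by intro i hi; omega, rfl, rfl, by simp⟩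
  | fwd _ e ih => exact step _ _ _ true (fun _ => e) (by simp) ih
  | bwd _ e ih => exact step _ _ _ false (by simp) (fun _ => e) ih

theorem aux_exists_pot {V : Type*} (E : V → V → Prop) (d : ℕ)
    (hc : ∀ L v s, AuxValid E L v s → v L = v 0 → (d : ℤ) ∣ ∑ i ∈ Finset.range L, aux_sg (s i)) :
    ∃ φ : V → ZMod d, ∀ a b, E a b → φ b = φ a + 1 := by
  have hr : ∀ x : V, ∃ N, AuxR E (Quot.mk E x).out x N := by
    intro x
    have : Relation.EqvGen E (Quot.mk E x).out x := Quot.eqvGen_exact (Quot.out_eq _)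
    generalize (Quot.mk E x).out = r at this
    induction this with
    | rel x y h => exact ⟨_, (AuxR.refl x).fwd h⟩
    | refl x => exact ⟨_, AuxR.refl x⟩
    | symm x y _ ih => obtain ⟨N, h⟩ := ih; exact ⟨_, h.symm'⟩
    | trans x y z _ _ ih1 ih2 =>
      obtain ⟨N, h⟩ := ih1
      obtain ⟨M, h'⟩ := ih2
      exact ⟨_, h.trans' h'⟩
  choose N hN using hr
  refine ⟨fun x => (N x : ZMod d), fun a b hab => ?_⟩
  have e : Quot.mk E a = Quot.mk E b := Quot.sound hab
  have h1 := hN a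
  rw [e] at h1
  have h2 := (h1.fwd hab).trans' (hN b).symm'
  obtain ⟨L, v, s, hv, h0, hL, hs⟩ := h2.walk
  have := hc L v s hv (hL.trans h0.symm)
  rw [hs] at this
  have := (ZMod.intCast_zmod_eq_zero_iff_dvd _ d).2 this
  push_cast at this
  linear_combination -this

theorem aux_pot_walk {V : Type*} (E : V → V → Prop) (d : ℕ) (φ : V → ZMod d)
    (h : ∀ a b, E a b → φ b = φ a + 1) (L v s) (hv : AuxValid E L v s) :
    ((∑ i ∈ Finset.range L, aux_sg (s i) : ℤ) : ZMod d) = φ (v L) - φ (v 0) := by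
  induction L with
  | zero => simp
  | succ k ih =>
    rw [Finset.sum_range_succ, Int.cast_add, ih fun i hi => hv i (by omega)]
    have := hv k (by omega)
    cases hs : s k
    · rw [h _ _ (this.2 hs)]; simp [aux_sg]; ring
    · rw [h _ _ (this.1 hs)]; simp [aux_sg]; ring

theorem aux_gamma (A : FinDigraph) (d : ℕ) :
    d ∣ gamma A ↔ ∃ φ : Fin A.1 → ZMod d, ∀ a b, A.2 a b → φ b = φ a + 1 := by
  unfold gamma
  rw [aux_dvd_setGcd]
  constructor
  · intro h
    apply aux_exists_pot
    apply aux_closed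
    have key : ∀ L v s, AuxValid A.2 L v s → 0 < L → v L = v 0 →
      (∀ i < L, ∀ j < L, v i = v j → i = j) → 0 < ∑ i ∈ Finset.range L, aux_sg (s i) → 
        (d : ℤ) ∣ ∑ i ∈ Finset.range L, aux_sg (s i) := by
      intro L v s hv hL h0 hinj hpos
      obtain ⟨m, hm⟩ := Int.eq_ofNat_of_zero_le hpos.le
      rw [hm] at hpos ⊢
      exact Int.natCast_dvd_natCast.2 (h m ⟨by exact_mod_cast hpos, ⟨L, v, s, hv⟩, ⟨hL, h0, hinj⟩,
        (aux_netLength _).trans hm⟩)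
    intro L v s hv hL h0 hinj
    rcases lt_trichotomy 0 (∑ i ∈ Finset.range L, aux_sg (s i)) with hp | hp | hp
    · exact key L v s hv hL h0 hinj hp
    · rw [← hp]; exact dvd_zero _
    have e : ∑ i ∈ Finset.range L, aux_sg (!s (L - 1 - i)) = - ∑ i ∈ Finset.range L, aux_sg (s i) := by
      rw [Finset.sum_range_reflect (fun i => aux_sg (!s i)), ← Finset.sum_neg_distrib]
      refine Finset.sum_congr rfl fun k _ => ?_
      cases s k <;> simp [aux_sg]
    have := key L (fun k => v (L - k)) (fun k => !s (L - 1 - k)) (by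
      intro i hi
      have := hv (L - 1 - i) (by omega)
      rw [show L - 1 - i + 1 = L - i by omega] at this
      simp only [show L - (i + 1) = L - 1 - i by omega]
      simpa using this.symm) hL (by simpa using h0.symm) (by
      intro i hi j hj hij
      rcases Nat.eq_zero_or_pos i with rfl | hi0 <;> rcases Nat.eq_zero_or_pos j with rfl | hj0
      · rfl
      · simp only [Nat.sub_zero, h0] at hij
        have := hinj _ (by omega) _ (by omega) hij
        omega
      · simp only [Nat.sub_zero, h0] at hij
        have := hinj _ (by omega) _ (by omega) hij
        omega
      · have := hinj _ (by omega) _ (by omega) hij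
        omega) (by rw [e]; linarith)
    rw [e] at this
    exact (dvd_neg).1 this
  · rintro ⟨φ, hφ⟩ m ⟨_, W, hW, hm⟩
    have := aux_pot_walk A.2 d φ hφ W.len W.vert W.sign W.valid
    rw [← aux_netLength, hm, hW.2.1, sub_self] at this
    rw [← ZMod.natCast_eq_zero_iff]
    simpa using this

theorem aux_hom {n : ℕ} (hn : 1 ≤ n) (A : NStruct n) (d m : ℕ) [NeZero d]
    (f : Fin A.1 → Fin (m * d)) :
    IsHomS A (copiesS m (naryCycle n d)) f ↔ ∀ a b, (star A).2 a b →
      (finProdFinEquiv.symm (f b)).1 = (finProdFinEquiv.symm (f a)).1 ∧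
      (((finProdFinEquiv.symm (f b)).2.val : ℕ) : ZMod d) =
        ((finProdFinEquiv.symm (f a)).2.val : ℕ) + 1 := by
  constructor
  · rintro h a b ⟨t, i, hi, ht, rfl, rfl⟩
    obtain ⟨c, s, ⟨k, hk⟩, hs⟩ := h t ht
    change Fin n → Fin d at s
    have h1 : f (t i) = finProdFinEquiv (c, s i) := hs i
    have h2 : f (t ⟨i.val + 1, hi⟩) = finProdFinEquiv (c, s ⟨i.val + 1, hi⟩) := hs _
    have k1 : (s i).val = _ := hk i
    have k2 : (s ⟨i.val + 1, hi⟩).val = _ := hk ⟨i.val + 1, hi⟩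
    rw [h1, h2, Equiv.symm_apply_apply, Equiv.symm_apply_apply]
    refine ⟨rfl, ?_⟩
    simp only [k1, k2, ZMod.natCast_mod]
    push_cast; ring
  · intro h t ht
    have hall : ∀ j : ℕ, ∀ hj : j < n,
      (finProdFinEquiv.symm (f (t ⟨j, hj⟩))).1 = (finProdFinEquiv.symm (f (t ⟨0, hn⟩))).1 ∧
      (((finProdFinEquiv.symm (f (t ⟨j, hj⟩))).2.val : ℕ) : ZMod d) =
        ((finProdFinEquiv.symm (f (t ⟨0, hn⟩))).2.val : ℕ) + (j : ℕ) := by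
      intro j
      induction j with
      | zero => intro hj; simp
      | succ j ih =>
        intro hj
        have h1 := ih (by omega)
        have h2 := h _ _ ⟨t, ⟨j, by omega⟩, hj, ht, rfl, rfl⟩
        refine ⟨h2.1.trans h1.1, ?_⟩
        rw [h2.2, h1.2]; push_cast; ring
    refine ⟨(finProdFinEquiv.symm (f (t ⟨0, hn⟩))).1,
      fun j => (finProdFinEquiv.symm (f (t j))).2,
      ⟨(finProdFinEquiv.symm (f (t ⟨0, hn⟩))).2, fun j => ?_⟩, fun j => ?_⟩
    · have := (hall j.1 j.2).2
      rw [← Nat.cast_add, ZMod.natCast_eq_natCast_iff'] at this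
      rw [← this]
      exact (Nat.mod_eq_of_lt (Fin.is_lt _)).symm
    · rw [← (hall j.1 j.2).1]
      exact (Equiv.apply_symm_apply finProdFinEquiv (f (t j))).symm

theorem aux_count {V : Type*} [Finite V] (E : V → V → Prop) (d m : ℕ) [NeZero d]
    (φ : V → ZMod d) (hφ : ∀ a b, E a b → φ b = φ a + 1) :
    Nat.card {g : V → Fin m × ZMod d // ∀ a b, E a b → (g b).1 = (g a).1 ∧ (g b).2 = (g a).2 + 1}
      = (m * d) ^ Nat.card (Quot E) := by
  have e : {g : V → Fin m × ZMod d // ∀ a b, E a b → (g b).1 = (g a).1 ∧ (g b).2 = (g a).2 + 1} ≃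
      (Quot E → Fin m × ZMod d) :=
    { toFun := fun g => Quot.lift (fun x => ((g.1 x).1, (g.1 x).2 - φ x)) (by
        intro a b hab
        have := g.2 a b hab
        simp [this.1, this.2, hφ a b hab])
      invFun := fun q => ⟨fun x => ((q (Quot.mk E x)).1, (q (Quot.mk E x)).2 + φ x), by
        intro a b hab
        simp [(Quot.sound hab : Quot.mk E a = Quot.mk E b), hφ a b hab, add_assoc]⟩
      left_inv := by
        intro g; ext x <;> simp
      right_inv := by
        intro q; funext x
        induction x using Quot.ind
        simp }
  rw [Nat.card_congr e, Nat.card_fun]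
  simp

theorem aux_homS {n : ℕ} (hn : 1 ≤ n) (A : NStruct n) (d m : ℕ) [NeZero d] :
    homS A (copiesS m (naryCycle n d)) =
    Nat.card {g : Fin A.1 → Fin m × ZMod d // ∀ a b, (star A).2 a b →
      (g b).1 = (g a).1 ∧ (g b).2 = (g a).2 + 1} := by
  refine Nat.card_congr (Equiv.subtypeEquiv (Equiv.arrowCongr (Equiv.refl _)
    (finProdFinEquiv.symm.trans ((Equiv.refl _).prodCongr (⟨fun i => (i.val : ZMod d), 
      fun x => ⟨x.val, ZMod.val_lt x⟩, fun i => Fin.ext (ZMod.val_cast_of_lt i.2),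
      fun x => by simp⟩ : Fin d ≃ ZMod d)))) fun f => ?_)
  exact aux_hom hn A d m f

/-- for `n ≥ 1`, a finite `n`-ary structure `A`, and positive `d, m`:
`hom(A, m·C_d^n) = 0` if `d ∤ γ(A*)`, and `hom(A, m·C_d^n) = (m·d)^{c(A*)}` if
`d ∣ γ(A*)`. -/
theorem stmt11 (n : ℕ) (hn : 1 ≤ n) (A : NStruct n) (d m : ℕ) (hd : 0 < d) (hm : 0 < m) :
    (¬ d ∣ gamma (star A) → homS A (copiesS m (naryCycle n d)) = 0) ∧
    (d ∣ gamma (star A) → homS A (copiesS m (naryCycle n d)) = (m * d) ^ comps (star A)) := by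
  haveI : NeZero d := ⟨hd.ne'⟩
  rw [aux_homS hn, aux_gamma]
  constructor
  · intro h
    have : IsEmpty {g : Fin A.1 → Fin m × ZMod d // ∀ a b, (star A).2 a b →
      (g b).1 = (g a).1 ∧ (g b).2 = (g a).2 + 1} :=
      ⟨fun g => h ⟨fun x => (g.1 x).2, fun a b hab => (g.2 a b hab).2⟩⟩
    exact Nat.card_of_isEmpty
  · rintro ⟨φ, hφ⟩
    exact aux_count (V := Fin A.1) (star A).2 d m φ hφ
end

section
/- For every n ≥ 2 and every first-order language L with finitely many relation symbols, no function or constant symbols, and at least one relation symbol of arity n, there exists a class 𝒞 of finite L-structures, closed under isomorphism, such that for every k the class 𝒞 is not decided by any adaptive left k-query algorithm over ℕ. -/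
open FirstOrder

/-- A finite `L`-structure: a nonempty finite domain `Fin card` together with an
`L`-structure on it. -/
structure FinStruct (L : Language) where
  card : ℕ
  pos : 0 < card
  str : L.Structure (Fin card)

/-- The number of `L`-homomorphisms from `A` to `B`. -/
noncomputable def homCountL {L : Language} (A B : FinStruct L) : ℕ :=
  Nat.card (@Language.Hom L (Fin A.card) (Fin B.card) A.str B.str)

/-- There exists an `L`-homomorphism from `A` to `B`. -/
def HomExL {L : Language} (A B : FinStruct L) : Prop :=
  Nonempty (@Language.Hom L (Fin A.card) (Fin B.card) A.str B.str)

/-- `A` and `B` are isomorphic `L`-structures. -/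
def IsoL {L : Language} (A B : FinStruct L) : Prop :=
  Nonempty (@Language.Equiv L (Fin A.card) (Fin B.card) A.str B.str)
/-- The run of an adaptive left query algorithm over ℕ on finite `L`-structures. -/
noncomputable def advRunL {L : Language} (G : List ℕ → FinStruct L) (A : FinStruct L) :
    ℕ → List ℕ
  | 0 => []
  | j + 1 => advRunL G A j ++ [homCountL (G (advRunL G A j)) A]


/-- Cyclic structure on `ZMod (2^r)` with step `2^j`. -/
noncomputable def cycS (L : Language) [L.IsRelational] (r j : ℕ) : FinStruct L where
  card := 2 ^ r
  pos := by positivity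
  str :=
    { funMap := fun f => isEmptyElim f
      RelMap := fun {m} _ x => ∀ h : 2 ≤ m,
        (ZMod.finEquiv (2 ^ r) (x ⟨1, by omega⟩) : ZMod (2 ^ r)) =
          ZMod.finEquiv (2 ^ r) (x ⟨0, by omega⟩) + 2 ^ j }

/-- Condition: `g` shifts by `s` along relation tuples. -/
def shiftCond {L : Language} (A : FinStruct L) (r : ℕ) (s : ZMod (2 ^ r))
    (g : Fin A.card → ZMod (2 ^ r)) : Prop :=
  ∀ (m : ℕ) (R : L.Relations m) (x : Fin m → Fin A.card), A.str.RelMap R x →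
    ∀ h : 2 ≤ m, g (x ⟨1, by omega⟩) = g (x ⟨0, by omega⟩) + s

noncomputable def homEquivShift {L : Language} [L.IsRelational] (A : FinStruct L) (r j : ℕ) :
    (@Language.Hom L (Fin A.card) (Fin (cycS L r j).card) A.str (cycS L r j).str) ≃
      {g : Fin A.card → ZMod (2 ^ r) // shiftCond A r (2 ^ j) g} :=
  letI := A.str
  letI := (cycS L r j).str
  { toFun := fun f => ⟨fun a => ZMod.finEquiv (2 ^ r) (f.toFun a), by
      intro m R x hx h
      exact f.map_rel' R x hx h⟩
    invFun := fun g =>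
      { toFun := fun a => (ZMod.finEquiv (2 ^ r)).symm (g.1 a)
        map_fun' := fun f => isEmptyElim f
        map_rel' := by
          intro m R x hx h
          have := g.2 m R x hx h
          exact ((ZMod.finEquiv (2 ^ r)).apply_symm_apply _).trans (this.trans
            (congrArg (fun z => z + 2 ^ j) ((ZMod.finEquiv (2 ^ r)).apply_symm_apply _).symm)) }
    left_inv := by
      intro f
      apply Language.Hom.ext
      intro a
      exact (ZMod.finEquiv (2 ^ r)).symm_apply_apply _
    right_inv := by
      intro g
      apply Subtype.ext
      funext a
      exact (ZMod.finEquiv (2 ^ r)).apply_symm_apply _ }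

lemma count_eq {L : Language} [L.IsRelational] (A : FinStruct L) (r j : ℕ) :
    homCountL A (cycS L r j) = Nat.card {g // shiftCond A r (2 ^ j) g} :=
  Nat.card_congr (homEquivShift A r j)

lemma count_of_ex {L : Language} [L.IsRelational] (A : FinStruct L) (r j : ℕ)
    (h : ∃ g, shiftCond A r (2 ^ j) g) :
    homCountL A (cycS L r j) = Nat.card {g // shiftCond A r 0 g} := by
  obtain ⟨g0, h0⟩ := h
  rw [count_eq]
  refine Nat.card_congr
    { toFun := fun g => ⟨g.1 - g0, ?_⟩
      invFun := fun d => ⟨d.1 + g0, ?_⟩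
      left_inv := fun g => by simp
      right_inv := fun g => by simp }
  · intro m R x hx hm
    have h1 := g.2 m R x hx hm
    have h2 := h0 m R x hx hm
    simp only [Pi.sub_apply, h1, h2]
    ring
  · intro m R x hx hm
    have h1 := d.2 m R x hx hm
    have h2 := h0 m R x hx hm
    simp only [Pi.add_apply, h1, h2]
    ring

lemma count_of_not_ex {L : Language} [L.IsRelational] (A : FinStruct L) (r j : ℕ)
    (h : ¬ ∃ g, shiftCond A r (2 ^ j) g) :
    homCountL A (cycS L r j) = 0 := by
  rw [count_eq]
  have : IsEmpty {g // shiftCond A r (2 ^ j) g} := ⟨fun g => h ⟨g.1, g.2⟩⟩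
  exact Nat.card_of_isEmpty

lemma ex_mono {L : Language} (A : FinStruct L) (r : ℕ) {i j : ℕ} (hij : i ≤ j)
    (h : ∃ g, shiftCond A r (2 ^ i) g) : ∃ g, shiftCond A r (2 ^ j) g := by
  obtain ⟨g, hg⟩ := h
  refine ⟨fun a => 2 ^ (j - i) * g a, ?_⟩
  intro m R x hx hm
  have h1 := hg m R x hx hm
  simp only [h1, mul_add, ← pow_add, Nat.sub_add_cancel hij]

lemma adversary {L : Language} [L.IsRelational] (G : List ℕ → FinStruct L) (r t : ℕ) :
    ∀ m, ∃ a l, a + 2 ^ m ≤ 2 ^ (m + t) ∧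
      ∀ j, a ≤ j → j ≤ a + 2 ^ m → advRunL G (cycS L r j) t = l := by
  induction t with
  | zero => exact fun m => ⟨0, [], by simp, fun j _ _ => rfl⟩
  | succ t ih =>
    intro m
    obtain ⟨a, l, hle, hl⟩ := ih (m + 1)
    have e1 : 2 ^ (m + 1) = 2 ^ m + 2 ^ m := by ring
    have e0 : 0 < 2 ^ m := by positivity
    have e2 : m + 1 + t = m + (t + 1) := by ring
    rw [e2] at hle
    by_cases hex : ∃ g, shiftCond (G l) r (2 ^ (a + 2 ^ m)) g
    · refine ⟨a + 2 ^ m, l ++ [Nat.card {g // shiftCond (G l) r 0 g}], by omega, ?_⟩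
      intro j h1 h2
      rw [advRunL, hl j (by omega) (by omega), count_of_ex _ _ _ (ex_mono _ _ h1 hex)]
    · refine ⟨a, l ++ [0], by omega, ?_⟩
      intro j h1 h2
      rw [advRunL, hl j (by omega) (by omega),
        count_of_not_ex _ _ _ (fun h => hex (ex_mono _ _ h2 h))]

lemma hom_le {L : Language} [L.IsRelational] {n : ℕ} (hn : 2 ≤ n) (R : L.Relations n)
    (r i j : ℕ) (hi : i ≤ r) (h : HomExL (cycS L r i) (cycS L r j)) : i ≤ j := by
  obtain ⟨f⟩ := h
  obtain ⟨g, hg⟩ := homEquivShift _ _ _ f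
  let e := ZMod.finEquiv (2 ^ r)
  have key : ∀ z : ZMod (2 ^ r), g (e.symm (z + 2 ^ i)) = g (e.symm z) + 2 ^ j := by
    intro z
    have := hg n R (fun q => if q.1 = 0 then e.symm z else e.symm (z + 2 ^ i))
      (by intro h; simp [e]) hn
    simpa using this
  have it : ∀ q : ℕ, g (e.symm (q * 2 ^ i)) = g (e.symm 0) + q * 2 ^ j := by
    intro q
    induction q with
    | zero => simp
    | succ q ih =>
      have := key (q * 2 ^ i)
      rw [ih] at this
      push_cast
      rw [add_mul, one_mul, this]
      ring
  have h1 := it (2 ^ (r - i))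
  have h2 : ((2 ^ (r - i) : ℕ) : ZMod (2 ^ r)) * 2 ^ i = 0 := by
    have : ((2 ^ r : ℕ) : ZMod (2 ^ r)) = 0 := ZMod.natCast_self _
    push_cast at this ⊢
    rw [← pow_add, Nat.sub_add_cancel hi, this]
  rw [h2] at h1
  have h3 : ((2 ^ (r - i + j) : ℕ) : ZMod (2 ^ r)) = 0 := by
    have := left_eq_add.mp h1
    push_cast at this ⊢
    rw [pow_add, this]
  rw [ZMod.natCast_eq_zero_iff, Nat.pow_dvd_pow_iff_le_right (by norm_num)] at h3
  omega

lemma IsoL.symm' {L : Language} {A B : FinStruct L} (h : IsoL A B) : IsoL B A := by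
  letI := A.str
  letI := B.str
  obtain ⟨f⟩ := h
  exact ⟨Language.Equiv.symm f⟩

lemma IsoL.trans' {L : Language} {A B C : FinStruct L} (h : IsoL A B) (h' : IsoL B C) :
    IsoL A C := by
  letI := A.str
  letI := B.str
  letI := C.str
  obtain ⟨f⟩ := h
  obtain ⟨f'⟩ := h'
  exact ⟨Language.Equiv.comp f' f⟩

lemma IsoL.hom' {L : Language} {A B : FinStruct L} (h : IsoL A B) : HomExL A B := by
  letI := A.str
  letI := B.str
  obtain ⟨f⟩ := h
  exact ⟨Language.Equiv.toHom f⟩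

lemma IsoL.card_eq' {L : Language} {A B : FinStruct L} (h : IsoL A B) : A.card = B.card := by
  letI := A.str
  letI := B.str
  obtain ⟨f⟩ := h
  exact Fin.equiv_iff_eq.mp ⟨Language.Equiv.toEquiv f⟩

/-- for every `n ≥ 2` and finite relational language `L` with a relation
symbol of arity `n`, there is an isomorphism-closed class of finite `L`-structures not
decided by any adaptive left `k`-query algorithm over ℕ. -/
theorem stmt12 (n : ℕ) (hn : 2 ≤ n) (L : Language) [L.IsRelational]
    [Finite (Σ k, L.Relations k)] (hrel : Nonempty (L.Relations n)) :
    ∃ C : Set (FinStruct L),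
      (∀ A B : FinStruct L, IsoL A B → (A ∈ C ↔ B ∈ C)) ∧
      ∀ (k : ℕ) (G : List ℕ → FinStruct L) (X : Set (List ℕ)),
        ¬ ∀ A : FinStruct L, (A ∈ C ↔ advRunL G A k ∈ X) := by
  obtain ⟨R⟩ := hrel
  refine ⟨{A | ∃ r j, j ≤ r ∧ Even j ∧ IsoL (cycS L r j) A}, ?_, ?_⟩
  · intro A B h
    constructor
    · rintro ⟨r, j, h1, h2, h3⟩
      exact ⟨r, j, h1, h2, h3.trans' h⟩
    · rintro ⟨r, j, h1, h2, h3⟩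
      exact ⟨r, j, h1, h2, h3.trans' h.symm'⟩
  · intro k G X hX
    have mem : ∀ r j, j ≤ r →
        (cycS L r j ∈ {A | ∃ r j, j ≤ r ∧ Even j ∧ IsoL (cycS L r j) A} ↔ Even j) := by
      intro r j hj
      constructor
      · rintro ⟨r', j', h1, h2, h3⟩
        have hc : 2 ^ r' = 2 ^ r := h3.card_eq'
        have hr : r' = r := Nat.pow_right_injective (le_refl 2) hc
        subst hr
        have := hom_le hn R _ _ _ h1 h3.hom'
        have := hom_le hn R _ _ _ hj h3.symm'.hom'
        have : j = j' := by omega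
        exact this ▸ h2
      · intro h
        exact ⟨r, j, hj, h, ⟨@Language.Equiv.refl L _ (cycS L r j).str⟩⟩
    obtain ⟨a, l, hle, hl⟩ := adversary G (2 ^ k) k 0
    simp only [pow_zero, zero_add] at hle hl
    have h1 := (mem (2 ^ k) a (by omega)).symm.trans (hX _)
    have h2 := (mem (2 ^ k) (a + 1) hle).symm.trans (hX _)
    rw [hl a (by omega) (by omega)] at h1
    rw [hl (a + 1) (by omega) (by omega)] at h2
    have := h1.trans h2.symm
    rw [Nat.even_add_one] at this
    tauto
end

section
/- The class 𝒞 of all finite digraphs that contain a directed cycle is decided by an adaptive left unbounded query algorithm over 𝔹, but for every k it is not decided by any adaptive left k-query algorithm over 𝔹. -/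
/-- The computation path of an adaptive left unbounded query algorithm over 𝔹 on
input `A`: `G` maps the sequence of previous answers either to the next queried
digraph or to a final verdict (`Sum.inr true` = YES, `Sum.inr false` = NO). -/
noncomputable def pathB (G : List Bool → FinDigraph ⊕ Bool) (A : FinDigraph) :
    ℕ → List Bool
  | 0 => []
  | j + 1 =>
    match G (pathB G A j) with
    | Sum.inl F => pathB G A j ++ [homB F A]
    | Sum.inr _ => pathB G A j

/-- A total adaptive left unbounded query algorithm over 𝔹 deciding the class `C`. -/
def UDecides (G : List Bool → FinDigraph ⊕ Bool) (C : Set FinDigraph) : Prop :=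
  (∀ A : FinDigraph, ∃ (j : ℕ) (b : Bool), G (pathB G A j) = Sum.inr b) ∧
  (∀ A : FinDigraph, A ∈ C ↔ ∃ j : ℕ, G (pathB G A j) = Sum.inr true)

/-- The run of an adaptive left bounded query algorithm over 𝔹. -/
noncomputable def advRunB (G : List Bool → FinDigraph) (A : FinDigraph) : ℕ → List Bool
  | 0 => []
  | j + 1 => advRunB G A j ++ [homB (G (advRunB G A j)) A]

/-- closed walk of length `l` -/
def CW (A : FinDigraph) (l : ℕ) : Prop :=
  0 < l ∧ ∃ w : ℕ → Fin A.1, (∀ i, A.2 (w i) (w (i+1))) ∧ ∀ i, w (i + l) = w i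

theorem mod_step (l i : ℕ) (hl : 0 < l) :
    ((i + 1) % l = i % l + 1 ∧ i % l + 1 < l) ∨ ((i + 1) % l = 0 ∧ i % l + 1 = l) := by
  have h := Nat.mod_lt i hl
  have e : (i + 1) % l = (i % l + 1) % l := by rw [Nat.mod_add_mod]
  rcases Nat.lt_or_ge (i % l + 1) l with h1 | h1
  · left
    rw [e, Nat.mod_eq_of_lt h1]
    exact ⟨rfl, h1⟩
  · right
    have h2 : i % l + 1 = l := by omega
    rw [e, h2, Nat.mod_self]
    exact ⟨rfl, rfl⟩

/-- close up a finite walk -/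
theorem cw_of_fin (A : FinDigraph) (l : ℕ) (hl : 0 < l) (w : ℕ → Fin A.1)
    (h : ∀ i < l, A.2 (w i) (w (i+1))) (hc : w l = w 0) : CW A l := by
  refine ⟨hl, fun i => w (i % l), ?_, ?_⟩
  · intro i
    have h0 := h (i % l) (Nat.mod_lt i hl)
    rcases mod_step l i hl with ⟨e, _⟩ | ⟨e, e2⟩
    · simp only [e]; exact h0
    · simp only [e]; rw [e2, hc] at h0; exact h0
  · intro i
    simp

theorem cw_of_cycle (A : FinDigraph) (l : ℕ) (h : HasDirCycle A l) : CW A l := by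
  obtain ⟨hl, v, -, hv⟩ := h
  refine ⟨hl, fun i => v ⟨i % l, Nat.mod_lt _ hl⟩, ?_, ?_⟩
  · intro i
    have := hv ⟨i % l, Nat.mod_lt _ hl⟩
    simpa using this
  · intro i; simp

theorem cycle_of_cw (A : FinDigraph) (l : ℕ) (h : CW A l) :
    ∃ m, HasDirCycle A m := by
  classical
  have hex : ∃ l, CW A l := ⟨l, h⟩
  have hmin := fun m (hm : m < Nat.find hex) => Nat.find_min hex hm
  obtain ⟨hl, w, hw, hp⟩ := Nat.find_spec hex
  generalize Nat.find hex = L at *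
  have key : ∀ i j, i < j → j < L → w i ≠ w j := by
    intro i j hij hj he
    apply hmin (j - i) (by omega)
    apply cw_of_fin A (j - i) (by omega) (fun t => w (i + t))
    · intro t _; exact hw (i + t)
    · simp only [Nat.add_zero]
      rw [he]; congr 1; omega
  refine ⟨L, hl, fun i => w i, ?_, ?_⟩
  · intro i j hij
    by_contra hne
    have hne' : i.1 ≠ j.1 := fun h => hne (Fin.ext h)
    rcases Nat.lt_or_gt_of_ne hne' with h1 | h1
    · exact key _ _ h1 j.2 hij
    · exact key _ _ h1 i.2 hij.symm
  · intro i
    have h0 := hw i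
    have hi := i.2
    rcases mod_step L i hl with ⟨e, _⟩ | ⟨e, e2⟩
    · simp only [e]; rw [Nat.mod_eq_of_lt hi]; exact h0
    · simp only [e]; rw [Nat.mod_eq_of_lt hi] at e2
      have := hp 0
      rw [Nat.zero_add] at this
      rw [e2, this] at h0; exact h0

theorem cycle_le (A : FinDigraph) (l : ℕ) (h : HasDirCycle A l) : l ≤ A.1 := by
  obtain ⟨hl, v, hv, -⟩ := h
  simpa using Fintype.card_le_of_injective v hv

theorem walk_of_transGen (A : FinDigraph) (u v : Fin A.1) (h : Relation.TransGen A.2 u v) :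
    ∃ l, 0 < l ∧ ∃ w : ℕ → Fin A.1, w 0 = u ∧ w l = v ∧ ∀ i < l, A.2 (w i) (w (i+1)) := by
  induction h with
  | single h =>
    rename_i b
    refine ⟨1, one_pos, fun i => if i = 0 then u else b, by simp, by simp, ?_⟩
    intro i hi
    have : i = 0 := by omega
    subst this
    simpa using h
  | tail _ h ih =>
    rename_i b c _
    obtain ⟨l, hl, w, h0, h1, h2⟩ := ih
    refine ⟨l + 1, by omega, fun i => if i ≤ l then w i else c, by simp [h0], by simp, ?_⟩
    intro i hi
    rcases Nat.lt_or_ge i l with h3 | h3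
    · have : i + 1 ≤ l := h3
      simp only [h3.le, this, if_true]
      exact h2 i h3
    · have : i = l := by omega
      subst this
      simpa [h1] using h

/-- acyclic digraphs have a strictly increasing ranking -/
theorem rank_of_acyclic (A : FinDigraph) (h : ¬ ∃ l, HasDirCycle A l) :
    ∃ r : Fin A.1 → ℕ, (∀ v, r v < A.1) ∧ ∀ u v, A.2 u v → r u < r v := by
  classical
  have irr : ∀ v, ¬ Relation.TransGen A.2 v v := by
    intro v hv
    obtain ⟨l, hl, w, h0, h1, h2⟩ := walk_of_transGen A v v hv
    exact h (cycle_of_cw A l (cw_of_fin A l hl w h2 (h1.trans h0.symm)))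
  refine ⟨fun v => (Finset.univ.filter fun u => Relation.TransGen A.2 u v).card, ?_, ?_⟩
  · intro v
    have : (Finset.univ.filter fun u => Relation.TransGen A.2 u v) ⊂ Finset.univ := by
      rw [Finset.ssubset_univ_iff]
      intro he
      have : v ∈ (Finset.univ.filter fun u => Relation.TransGen A.2 u v) := by
        rw [he]; exact Finset.mem_univ v
      exact irr v (by simpa using this)
    simpa using Finset.card_lt_card this
  · intro u v huv
    apply Finset.card_lt_card
    rw [Finset.ssubset_iff_of_subset]
    · refine ⟨u, by simpa using Relation.TransGen.single huv, by simpa using irr u⟩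
    · intro x hx
      simp only [Finset.mem_filter, Finset.mem_univ, true_and] at hx ⊢
      exact hx.tail huv

theorem no_cw_of_rank (A : FinDigraph) (r : Fin A.1 → ℕ) (hr : ∀ u v, A.2 u v → r u < r v)
    (l : ℕ) : ¬ CW A l := by
  rintro ⟨hl, w, hw, hp⟩
  have hm : StrictMono (fun i => r (w i)) := strictMono_nat_of_lt_succ fun i => hr _ _ (hw i)
  have h1 := hm hl
  have h2 := hp 0
  rw [Nat.zero_add] at h2
  simp only [h2] at h1
  omega

theorem cw_map (A B : FinDigraph) (f) (hf : IsHom A B f) (l : ℕ) (h : CW A l) : CW B l := by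
  obtain ⟨hl, w, hw, hp⟩ := h
  exact ⟨hl, fun i => f (w i), fun i => hf _ _ (hw i), fun i => by simp only [hp]⟩

/-- directed path on `m` vertices -/
def pathG (m : ℕ) : FinDigraph := ⟨m, fun a b => a.1 + 1 = b.1⟩
/-- directed cycle on `m+1` vertices -/
def cycG (m : ℕ) : FinDigraph := ⟨m + 1, fun a b => (a.1 + 1) % (m + 1) = b.1⟩

theorem path_hom (A : FinDigraph) (l m : ℕ) (h : CW A l) : homB (pathG m) A = true := by
  rw [homB_iff]
  obtain ⟨hl, w, hw, hp⟩ := h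
  refine ⟨fun i => w i.1, ?_⟩
  intro a b hab
  have hab' : a.1 + 1 = b.1 := hab
  have := hw a.1
  rw [hab'] at this
  exact this

theorem path_no_hom (A : FinDigraph) (h : ¬ ∃ l, HasDirCycle A l) :
    homB (pathG (A.1 + 1)) A = false := by
  rw [← Bool.not_eq_true, homB_iff]
  rintro ⟨f, hf⟩
  obtain ⟨r, hr1, hr2⟩ := rank_of_acyclic A h
  have key : ∀ i (hi : i < A.1 + 1), i ≤ r (f ⟨i, hi⟩) := by
    intro i
    induction i with
    | zero => intro _; exact Nat.zero_le _
    | succ i ih =>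
      intro hi
      have h1 := ih (by omega)
      have h2 := hr2 _ _ (hf ⟨i, by show i < A.1 + 1; omega⟩ ⟨i + 1, hi⟩ rfl)
      omega
  have h1 := key A.1 (by omega)
  have h2 := hr1 (f ⟨A.1, by show A.1 < A.1 + 1; omega⟩)
  omega

theorem cw_of_cyc_hom (A : FinDigraph) (m : ℕ) (h : homB (cycG m) A = true) : CW A (m + 1) := by
  rw [homB_iff] at h
  obtain ⟨f, hf⟩ := h
  apply cw_map _ _ f hf
  refine ⟨by omega, fun i => ⟨i % (m + 1), Nat.mod_lt _ (by omega)⟩, ?_, ?_⟩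
  · intro i
    show (i % (m + 1) + 1) % (m + 1) = (i + 1) % (m + 1)
    rw [Nat.mod_add_mod]
  · intro i; simp

theorem cyc_hom (A : FinDigraph) (m : ℕ) (h : HasDirCycle A (m + 1)) :
    homB (cycG m) A = true := by
  rw [homB_iff]
  obtain ⟨hl, v, -, hv⟩ := h
  refine ⟨v, ?_⟩
  intro a b hab
  have hab' : (a.1 + 1) % (m + 1) = b.1 := hab
  have := hv a
  have e : (⟨(a.1 + 1) % (m + 1), Nat.mod_lt _ hl⟩ : Fin (m + 1)) = b := Fin.ext hab'
  rw [e] at this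
  exact this

/-- query sequence -/
def qG (n : ℕ) : FinDigraph := if n % 2 = 0 then pathG (n / 2) else cycG (n / 2)

theorem qG_even (i : ℕ) : qG (2 * i) = pathG i := by
  unfold qG; rw [if_pos (by omega)]; congr 1; omega
theorem qG_odd (i : ℕ) : qG (2 * i + 1) = cycG i := by
  unfold qG; rw [if_neg (by omega)]; congr 1; omega

open Classical in
/-- the unbounded algorithm -/
noncomputable def algG (s : List Bool) : FinDigraph ⊕ Bool :=
  if ∃ i, s[2 * i]? = some false then Sum.inr false
  else if ∃ i, s[2 * i + 1]? = some true then Sum.inr true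
  else Sum.inl (qG s.length)

/-- answers -/
noncomputable def ans (A : FinDigraph) (m : ℕ) : List Bool :=
  (List.range m).map fun i => homB (qG i) A

theorem ans_get (A : FinDigraph) (m i : ℕ) (b : Bool) :
    (ans A m)[i]? = some b ↔ i < m ∧ homB (qG i) A = b := by
  unfold ans
  rcases Nat.lt_or_ge i m with h | h
  · simp [h]
  · simp [h, Nat.not_lt.mpr h]

theorem path_inv (A : FinDigraph) (j : ℕ) :
    ∃ m, pathB algG A j = ans A m ∧ (m = j ∨ ∃ b, algG (pathB algG A j) = Sum.inr b) := by
  induction j with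
  | zero => exact ⟨0, rfl, Or.inl rfl⟩
  | succ j ih =>
    obtain ⟨m, h1, h2⟩ := ih
    cases hG : algG (pathB algG A j) with
    | inr b =>
      have e : pathB algG A (j + 1) = pathB algG A j := by
        rw [pathB, hG]
      exact ⟨m, e.trans h1, Or.inr ⟨b, by rw [e, hG]⟩⟩
    | inl F =>
      have e : pathB algG A (j + 1) = pathB algG A j ++ [homB F A] := by
        rw [pathB, hG]
      have hm : m = j := by
        rcases h2 with h2 | ⟨b, hb⟩
        · exact h2
        · rw [hG] at hb; cases hb
      subst hm
      refine ⟨m + 1, ?_, Or.inl rfl⟩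
      have hF : F = qG m := by
        rw [h1] at hG
        unfold algG at hG
        split_ifs at hG
        have := Sum.inl.inj hG
        rw [← this]
        simp [ans]
      rw [e, h1, hF]
      simp [ans, List.range_succ]

theorem part1 : UDecides algG {A : FinDigraph | ∃ l : ℕ, HasDirCycle A l} := by
  have tot : ∀ A : FinDigraph, ∃ (j : ℕ) (b : Bool), algG (pathB algG A j) = Sum.inr b := by
    intro A
    by_contra hcon
    have hp : ∀ j, pathB algG A j = ans A j := by
      intro j
      obtain ⟨m, h1, h2 | h2⟩ := path_inv A j
      · rw [h1, h2]
      · exact absurd ⟨j, h2⟩ hcon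
    have hn : ∀ j, ¬ ∃ b, algG (ans A j) = Sum.inr b := by
      intro j hj
      rw [← hp j] at hj
      exact hcon ⟨j, hj⟩
    by_cases hc : ∃ l, HasDirCycle A l
    · obtain ⟨l, hl⟩ := hc
      obtain ⟨l, rfl⟩ : ∃ l', l = l' + 1 := ⟨l - 1, by have := hl.1; omega⟩
      apply hn (2 * l + 2)
      have : ∃ i, (ans A (2 * l + 2))[2 * i + 1]? = some true := by
        refine ⟨l, ?_⟩
        rw [ans_get, qG_odd]
        exact ⟨by omega, cyc_hom A l hl⟩
      unfold algG
      split_ifs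
      · exact ⟨_, rfl⟩
      · exact ⟨_, rfl⟩
    · apply hn (2 * (A.1 + 1) + 1)
      have : ∃ i, (ans A (2 * (A.1 + 1) + 1))[2 * i]? = some false := by
        refine ⟨A.1 + 1, ?_⟩
        rw [ans_get, qG_even]
        exact ⟨by omega, path_no_hom A hc⟩
      unfold algG
      rw [if_pos this]
      exact ⟨_, rfl⟩
  refine ⟨tot, ?_⟩
  intro A
  constructor
  · rintro ⟨l, hl⟩
    obtain ⟨j, b, hj⟩ := tot A
    cases b with
    | true => exact ⟨j, hj⟩
    | false =>
      exfalso
      obtain ⟨m, h1, -⟩ := path_inv A j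
      rw [h1] at hj
      unfold algG at hj
      split_ifs at hj with h2 h3
      · obtain ⟨i, hi⟩ := h2
        rw [ans_get, qG_even, path_hom A l i (cw_of_cycle A l hl)] at hi
        exact absurd hi.2 (by simp)
      · simp at hj
  · rintro ⟨j, hj⟩
    obtain ⟨m, h1, -⟩ := path_inv A j
    rw [h1] at hj
    unfold algG at hj
    split_ifs at hj with h2 h3
    · simp at hj
    · obtain ⟨i, hi⟩ := h3
      rw [ans_get, qG_odd] at hi
      exact cycle_of_cw A _ (cw_of_cyc_hom A i hi.2)

open Classical in
/-- canonical run -/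
noncomputable def canRun (G : List Bool → FinDigraph) : ℕ → List Bool
  | 0 => []
  | j + 1 => canRun G j ++ [decide (¬ ∃ l, HasDirCycle (G (canRun G j)) l)]

theorem good_hom (N : ℕ) (A : FinDigraph) (hA : ∀ l ≤ N, ¬ CW A l)
    (e : ℕ → Fin A.1) (he : ∀ a b, a < b → b < N → A.2 (e a) (e b))
    (F : FinDigraph) (hF : F.1 ≤ N) :
    homB F A = true ↔ ¬ ∃ l, HasDirCycle F l := by
  rw [homB_iff]
  constructor
  · rintro ⟨f, hf⟩ ⟨l, hl⟩
    exact hA l ((cycle_le F l hl).trans hF) (cw_map F A f hf l (cw_of_cycle F l hl))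
  · intro h
    obtain ⟨r, hr1, hr2⟩ := rank_of_acyclic F h
    exact ⟨fun v => e (r v), fun a b hab => he _ _ (hr2 a b hab) ((hr1 b).trans_le hF)⟩

theorem run_eq_s13 (N k : ℕ) (G : List Bool → FinDigraph) (hN : ∀ j < k, (G (canRun G j)).1 ≤ N)
    (A : FinDigraph)
    (hA : ∀ F : FinDigraph, F.1 ≤ N → (homB F A = true ↔ ¬ ∃ l, HasDirCycle F l)) :
    ∀ j ≤ k, advRunB G A j = canRun G j := by
  intro j
  induction j with
  | zero => intro _; rfl
  | succ j ih =>
    intro hj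
    have h1 := ih (by omega)
    rw [advRunB, canRun, h1]
    congr 2
    rw [Bool.eq_iff_iff, hA _ (hN j (by omega))]
    simp

/-- transitive tournament -/
def tourG (N : ℕ) : FinDigraph := ⟨N + 1, fun a b => a.1 < b.1⟩
/-- a graph with a long cycle and a large tournament -/
def bigG (N : ℕ) : FinDigraph :=
  ⟨2 * N + 1, fun a b => (a.1 < b.1 ∧ (b.1 < N ∨ b.1 = a.1 + 1)) ∨ (a.1 = 2 * N ∧ b.1 = N)⟩

theorem big_no_cw (N l : ℕ) (hl : l ≤ N) : ¬ CW (bigG N) l := by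
  rintro ⟨h0, w, hw, hp⟩
  have hw' : ∀ i, ((w i).1 < (w (i+1)).1 ∧ ((w (i+1)).1 < N ∨ (w (i+1)).1 = (w i).1 + 1)) ∨
    ((w i).1 = 2 * N ∧ (w (i+1)).1 = N) := hw
  by_cases hb : ∃ i, (w i).1 = 2 * N ∧ (w (i+1)).1 = N
  · obtain ⟨i, -, hi⟩ := hb
    have key : ∀ t ≤ N, (w (i + 1 + t)).1 = N + t := by
      intro t
      induction t with
      | zero => intro _; exact hi
      | succ t ih =>
        intro ht
        have h1 := ih (by omega)
        have h2 := hw' (i + 1 + t)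
        rw [Nat.add_assoc (i + 1) t 1] at h2
        omega
    have h1 := key l hl
    rw [hp (i + 1)] at h1
    omega
  · have hm : StrictMono (fun i => (w i).1) := strictMono_nat_of_lt_succ fun i => by
      rcases hw' i with h | h
      · exact h.1
      · exact absurd ⟨i, h⟩ hb
    have h1 := hm h0
    have h2 := hp 0
    rw [Nat.zero_add] at h2
    simp only [h2] at h1
    omega

theorem big_cycle (N : ℕ) : HasDirCycle (bigG N) (N + 1) := by
  refine ⟨by omega, fun i => ⟨N + i.1, by show N + i.1 < 2 * N + 1; omega⟩, ?_, ?_⟩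
  · intro i j hij
    have : N + i.1 = N + j.1 := congrArg Fin.val hij
    exact Fin.ext (by omega)
  · intro i
    show (N + i.1 < N + (i.1 + 1) % (N + 1) ∧ (N + (i.1 + 1) % (N + 1) < N ∨
      N + (i.1 + 1) % (N + 1) = N + i.1 + 1)) ∨ (N + i.1 = 2 * N ∧ N + (i.1 + 1) % (N + 1) = N)
    have hi := i.2
    have e := Nat.mod_eq_of_lt hi
    rcases mod_step (N + 1) i.1 (by omega) with h | h <;> omega

theorem stmt13 :
    (∃ G : List Bool → FinDigraph ⊕ Bool,
      UDecides G {A : FinDigraph | ∃ l : ℕ, HasDirCycle A l}) ∧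
    (∀ (k : ℕ) (G : List Bool → FinDigraph) (X : Set (List Bool)),
      ¬ ∀ A : FinDigraph, ((∃ l : ℕ, HasDirCycle A l) ↔ advRunB G A k ∈ X)) := by
  refine ⟨⟨algG, part1⟩, ?_⟩
  intro k G X hX
  let N := ∑ j ∈ Finset.range k, (G (canRun G j)).1
  have hN : ∀ j < k, (G (canRun G j)).1 ≤ N := fun j hj =>
    Finset.single_le_sum (f := fun j => (G (canRun G j)).1) (fun _ _ => Nat.zero_le _)
      (Finset.mem_range.mpr hj)
  have hT : ∀ l, ¬ CW (tourG N) l :=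
    no_cw_of_rank (tourG N) (fun v => v.1) (fun _ _ h => h)
  have h1 := run_eq_s13 N k G hN (tourG N)
    (good_hom N (tourG N) (fun l _ => hT l)
      (fun i => ⟨min i N, by show min i N < N + 1; omega⟩)
      (fun a b hab hb => by show min a N < min b N; omega)) k le_rfl
  have h2 := run_eq_s13 N k G hN (bigG N)
    (good_hom N (bigG N) (fun l hl => big_no_cw N l hl)
      (fun i => ⟨min i N, by show min i N < 2 * N + 1; omega⟩)
      (fun a b hab hb => Or.inl (by
        show min a N < min b N ∧ (min b N < N ∨ min b N = min a N + 1)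
        omega))) k le_rfl
  have h3 := (hX (bigG N)).1 ⟨_, big_cycle N⟩
  rw [h2, ← h1] at h3
  obtain ⟨l, hl⟩ := (hX (tourG N)).2 h3
  exact hT l (cw_of_cycle _ _ hl)
end

section
/- Let L be a first-order language with finitely many relation symbols and no function or constant symbols. A class 𝒞 of finite L-structures is decided by an adaptive left unbounded query algorithm over 𝔹 if and only if 𝒞 is a clopen set in the topological space of finite L-structures equipped with the topology 𝔗. -/
open FirstOrder

/-- `upSet A` is the class of finite `L`-structures admitting a homomorphism from `A`. -/
def upSet {L : Language} (A : FinStruct L) : Set (FinStruct L) := {B | HomExL A B}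

/-- The topology 𝔗 on finite `L`-structures, generated by the subbasis consisting of
all classes `↑A` and all their complements. -/
def structTop (L : Language) : TopologicalSpace (FinStruct L) :=
  TopologicalSpace.generateFrom
    ({S | ∃ A : FinStruct L, S = upSet A} ∪ {S | ∃ A : FinStruct L, S = (upSet A)ᶜ})
open scoped Classical in
/-- The Boolean homomorphism-existence value for `L`-structures. -/
noncomputable def homBL {L : Language} (A B : FinStruct L) : Bool :=
  if HomExL A B then true else false

/-- The computation path of an adaptive left unbounded query algorithm over 𝔹 on
finite `L`-structures: `G` maps the previous answers either to the next queried
structure or to a final verdict (`Sum.inr true` = YES, `Sum.inr false` = NO). -/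
noncomputable def pathBL {L : Language} (G : List Bool → FinStruct L ⊕ Bool)
    (A : FinStruct L) : ℕ → List Bool
  | 0 => []
  | j + 1 =>
    match G (pathBL G A j) with
    | Sum.inl F => pathBL G A j ++ [homBL F A]
    | Sum.inr _ => pathBL G A j

/-- A total adaptive left unbounded query algorithm over 𝔹 deciding the class `C`. -/
def UDecidesL {L : Language} (G : List Bool → FinStruct L ⊕ Bool)
    (C : Set (FinStruct L)) : Prop :=
  (∀ A : FinStruct L, ∃ (j : ℕ) (b : Bool), G (pathBL G A j) = Sum.inr b) ∧
  (∀ A : FinStruct L, A ∈ C ↔ ∃ j : ℕ, G (pathBL G A j) = Sum.inr true)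
theorem aux_homBL_eq {L : Language} (F A B : FinStruct L) :
    homBL F B = homBL F A ↔ (B ∈ upSet F ↔ A ∈ upSet F) := by
  unfold homBL upSet
  by_cases h1 : HomExL F B <;> by_cases h2 : HomExL F A <;> simp [h1, h2]

theorem aux_ev_hom {L : Language} (F A : FinStruct L) :
    ∀ᶠ B in @nhds _ (structTop L) A, homBL F B = homBL F A := by
  letI := structTop L
  have h1 : IsOpen (upSet F) :=
    TopologicalSpace.isOpen_generateFrom_of_mem (Or.inl ⟨F, rfl⟩)
  have h2 : IsOpen (upSet F)ᶜ :=
    TopologicalSpace.isOpen_generateFrom_of_mem (Or.inr ⟨F, rfl⟩)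
  by_cases h : A ∈ upSet F
  · filter_upwards [h1.mem_nhds h] with B hB
    rw [aux_homBL_eq]; exact iff_of_true hB h
  · filter_upwards [h2.mem_nhds h] with B hB
    rw [aux_homBL_eq]; exact iff_of_false hB h

theorem aux_ev_path {L : Language} (G : List Bool → FinStruct L ⊕ Bool) (A : FinStruct L) (j : ℕ) :
    ∀ᶠ B in @nhds _ (structTop L) A, pathBL G B j = pathBL G A j := by
  letI := structTop L
  induction j with
  | zero => exact Filter.Eventually.of_forall fun B => rfl
  | succ j ih =>
    rcases h : G (pathBL G A j) with F | b
    · filter_upwards [ih, aux_ev_hom F A] with B h1 h2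
      simp only [pathBL, h1, h, h2]
    · filter_upwards [ih] with B h1
      simp only [pathBL, h1, h]

theorem aux_stable {L : Language} (G : List Bool → FinStruct L ⊕ Bool) (A : FinStruct L) (j k : ℕ)
    (b : Bool) (h : G (pathBL G A j) = Sum.inr b) : pathBL G A (j + k) = pathBL G A j := by
  induction k with
  | zero => rfl
  | succ k ih =>
    rw [← add_assoc]
    simp only [pathBL, ih, h]

theorem aux_unique {L : Language} (G : List Bool → FinStruct L ⊕ Bool) (A : FinStruct L) (j k : ℕ)
    (b c : Bool) (h : G (pathBL G A j) = Sum.inr b) (h' : G (pathBL G A k) = Sum.inr c) :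
    b = c := by
  have h1 := aux_stable G A j k b h
  have h2 := aux_stable G A k j c h'
  rw [add_comm, h1] at h2
  rw [← h2, h] at h'
  exact Sum.inr.inj h'

theorem aux_forward {L : Language} (G : List Bool → FinStruct L ⊕ Bool) {C : Set (FinStruct L)}
    (hG : UDecidesL G C) : @IsClopen _ (structTop L) C := by
  letI := structTop L
  obtain ⟨h1, h2⟩ := hG
  constructor
  · rw [← isOpen_compl_iff, isOpen_iff_mem_nhds]
    intro A hA
    obtain ⟨j, b, hb⟩ := h1 A
    have hbf : b = false := by
      cases b with
      | false => rfl
      | true => exact absurd ((h2 A).2 ⟨j, hb⟩) hA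
    subst hbf
    filter_upwards [aux_ev_path G A j] with B hB hBC
    obtain ⟨k, hk⟩ := (h2 B).1 hBC
    rw [← hB] at hb
    exact absurd (aux_unique G B j k _ _ hb hk) (by simp)
  · rw [isOpen_iff_mem_nhds]
    intro A hA
    obtain ⟨j, hb⟩ := (h2 A).1 hA
    filter_upwards [aux_ev_path G A j] with B hB
    exact (h2 B).2 ⟨j, by rw [hB, hb]⟩

theorem aux_countable (L : Language) [L.IsRelational] [Finite (Σ n, L.Relations n)] :
    Countable (FinStruct L) := by
  have hs : ∀ n, Countable (L.Structure (Fin n)) := by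
    intro n
    have : Function.Injective (fun (S : L.Structure (Fin n)) =>
        (fun (r : Σ n, L.Relations n) => (fun x => S.RelMap r.2 x : (Fin r.1 → Fin n) → Prop))) := by
      intro S T h
      refine Language.Structure.ext ?_ ?_
      · funext k f
        exact isEmptyElim f
      · funext k r
        exact congrFun h ⟨k, r⟩
    exact this.countable
  have : Function.Injective (fun (A : FinStruct L) =>
      (⟨A.card, A.str⟩ : Σ n, L.Structure (Fin n))) := by
    rintro ⟨n, hn, S⟩ ⟨m, hm, T⟩ h
    simp only [Sigma.mk.injEq] at h
    obtain ⟨rfl, h⟩ := h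
    cases h
    rfl
  exact this.countable

theorem aux_open_det {L : Language} (F : ℕ → FinStruct L) (hF : Function.Surjective F)
    (U : Set (FinStruct L)) (hU : @IsOpen _ (structTop L) U) :
    ∀ A ∈ U, ∃ n : ℕ, ∀ B, (∀ i < n, homBL (F i) B = homBL (F i) A) → B ∈ U := by
  have hU' : TopologicalSpace.GenerateOpen _ U := hU
  induction hU' with
  | basic s hs =>
    intro A hA
    rcases hs with ⟨X, rfl⟩ | ⟨X, rfl⟩
    · obtain ⟨k, rfl⟩ := hF X
      exact ⟨k + 1, fun B hB => ((aux_homBL_eq _ _ _).1 (hB k (Nat.lt_succ_self k))).2 hA⟩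
    · obtain ⟨k, rfl⟩ := hF X
      exact ⟨k + 1, fun B hB hh =>
        hA (((aux_homBL_eq _ _ _).1 (hB k (Nat.lt_succ_self k))).1 hh)⟩
  | univ => exact fun A _ => ⟨0, fun B _ => trivial⟩
  | inter s t hs ht ihs iht =>
    intro A hA
    obtain ⟨n, hn⟩ := ihs hs A hA.1
    obtain ⟨m, hm⟩ := iht ht A hA.2
    exact ⟨max n m, fun B hB => ⟨hn B fun i hi => hB i (lt_max_of_lt_left hi),
      hm B fun i hi => hB i (lt_max_of_lt_right hi)⟩⟩
  | sUnion S hS ih =>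
    rintro A ⟨s, hs, hA⟩
    obtain ⟨n, hn⟩ := ih s hs (hS s hs) A hA
    exact ⟨n, fun B hB => ⟨s, hs, hn B hB⟩⟩

/-- The vector of the first `n` answers. -/
noncomputable def auxVec {L : Language} (F : ℕ → FinStruct L) (A : FinStruct L) (n : ℕ) :
    List Bool := (List.range n).map fun i => homBL (F i) A

open scoped Classical in
/-- The algorithm. -/
noncomputable def auxG {L : Language} (F : ℕ → FinStruct L) (C : Set (FinStruct L))
    (σ : List Bool) : FinStruct L ⊕ Bool :=
  if ∀ B, auxVec F B σ.length = σ → B ∈ C then Sum.inr true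
  else if ∀ B, auxVec F B σ.length = σ → B ∉ C then Sum.inr false
  else Sum.inl (F σ.length)

theorem auxVec_length {L : Language} (F : ℕ → FinStruct L) (A : FinStruct L) (n : ℕ) :
    (auxVec F A n).length = n := by simp [auxVec]

theorem aux_path {L : Language} (F : ℕ → FinStruct L) (C : Set (FinStruct L)) (A : FinStruct L)
    (j : ℕ) : ∃ k, pathBL (auxG F C) A j = auxVec F A k ∧
      (k = j ∨ ∃ b, auxG F C (pathBL (auxG F C) A j) = Sum.inr b) := by
  induction j with
  | zero => exact ⟨0, rfl, Or.inl rfl⟩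
  | succ j ih =>
    obtain ⟨k, hk, h⟩ := ih
    rcases hG : auxG F C (pathBL (auxG F C) A j) with X | b
    · have hkj : k = j := by
        rcases h with h | ⟨b, hb⟩
        · exact h
        · rw [hG] at hb; cases hb
      subst hkj
      refine ⟨k + 1, ?_, Or.inl rfl⟩
      have hX : X = F k := by
        rw [hk] at hG
        unfold auxG at hG
        rw [auxVec_length] at hG
        split_ifs at hG
        exact (Sum.inl.inj hG).symm
      simp only [pathBL, hG]
      rw [hk, hX]
      simp [auxVec, List.range_succ]
    · have e : pathBL (auxG F C) A (j + 1) = pathBL (auxG F C) A j := by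
        simp only [pathBL, hG]
      exact ⟨k, e.trans hk, Or.inr ⟨b, by rw [e, hG]⟩⟩

theorem aux_sound {L : Language} (F : ℕ → FinStruct L) (C : Set (FinStruct L)) (A : FinStruct L)
    (j : ℕ) (b : Bool) (h : auxG F C (pathBL (auxG F C) A j) = Sum.inr b) :
    A ∈ C ↔ b = true := by
  obtain ⟨k, hk, -⟩ := aux_path F C A j
  rw [hk] at h
  unfold auxG at h
  rw [auxVec_length] at h
  split_ifs at h with h1 h2
  · exact iff_of_true (h1 A rfl) (Sum.inr.inj h).symm
  · refine iff_of_false (h2 A rfl) ?_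
    rw [← Sum.inr.inj h]; simp

theorem aux_vec_eq {L : Language} (F : ℕ → FinStruct L) (A B : FinStruct L) (n : ℕ)
    (h : auxVec F B n = auxVec F A n) : ∀ i < n, homBL (F i) B = homBL (F i) A := by
  intro i hi
  unfold auxVec at h
  rw [List.map_inj_left] at h
  exact h i (List.mem_range.2 hi)

theorem aux_backward {L : Language} [L.IsRelational] [Finite (Σ n, L.Relations n)]
    (C : Set (FinStruct L)) (hC : @IsClopen _ (structTop L) C) :
    ∃ G : List Bool → FinStruct L ⊕ Bool, UDecidesL G C := by
  haveI := aux_countable L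
  haveI : Nonempty (FinStruct L) :=
    ⟨⟨1, Nat.one_pos, ⟨fun f => isEmptyElim f, fun _ _ => False⟩⟩⟩
  obtain ⟨F, hF⟩ := exists_surjective_nat (FinStruct L)
  have hhalt : ∀ A : FinStruct L, ∃ (j : ℕ) (b : Bool),
      auxG F C (pathBL (auxG F C) A j) = Sum.inr b := by
    intro A
    have key : ∃ n b, auxG F C (auxVec F A n) = Sum.inr b := by
      by_cases hA : A ∈ C
      · obtain ⟨n, hn⟩ := aux_open_det F hF C hC.2 A hA
        refine ⟨n, true, ?_⟩
        unfold auxG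
        rw [auxVec_length, if_pos]
        exact fun B hB => hn B (aux_vec_eq F A B n hB)
      · obtain ⟨n, hn⟩ := aux_open_det F hF Cᶜ hC.1.isOpen_compl A hA
        refine ⟨n, false, ?_⟩
        unfold auxG
        rw [auxVec_length, if_neg, if_pos]
        · exact fun B hB => hn B (aux_vec_eq F A B n hB)
        · exact fun h => hA (h A rfl)
    obtain ⟨n, b, hb⟩ := key
    obtain ⟨k, hk, h⟩ := aux_path F C A n
    rcases h with rfl | ⟨c, hc⟩
    · exact ⟨k, b, by rw [hk, hb]⟩
    · exact ⟨n, c, hc⟩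
  refine ⟨auxG F C, hhalt, fun A => ⟨fun hA => ?_, ?_⟩⟩
  · obtain ⟨j, b, hb⟩ := hhalt A
    have := (aux_sound F C A j b hb).1 hA
    exact ⟨j, by rw [hb, this]⟩
  · rintro ⟨j, hj⟩
    exact (aux_sound F C A j true hj).2 rfl

/-- a class of finite `L`-structures is decided by an adaptive left
unbounded query algorithm over 𝔹 iff it is clopen in the topology 𝔗. -/
theorem stmt14 (L : Language) [L.IsRelational] [Finite (Σ n, L.Relations n)]
    (C : Set (FinStruct L)) :
    (∃ G : List Bool → FinStruct L ⊕ Bool, UDecidesL G C) ↔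
      @IsClopen _ (structTop L) C := by
  constructor
  · rintro ⟨G, hG⟩
    exact aux_forward G hG
  · exact aux_backward C
end
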